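/- arXiv:2202.12625 — 4 statements merged into one kernel-verified Lean document; each statement's English description precedes it below -/
import Mathlib

section
/- Let $(y^i)_{i=1}^M \subset \mathbb{C}^m$ be a frame with bounds $0 < A \le B < \infty$. Let $p, t \in (0,1)$ and $n \in \mathbb{N}$ satisfy $n \ge \frac{3B}{A t^2} m \log(\frac{2m}{p})$. Draw indices $j_1, \dots, j_n \in \{1,\dots,M\}$ independently, each with distribution $\mathbb{P}(j = i) = \varrho_i := \|y^i\|_2^2 / \sum_{k=1}^M \|y^k\|_2^2$. Then with probability exceeding $1 - p$ the following holds: for all $a \in \mathbb{C}^m$, $(1-t) A \|a\|_2^2 \le \frac{1}{n} \sum_{k=1}^n \varrho_{j_k}^{-1} |\langle a, y^{j_k} \rangle|^2 \le (1+t) B \|a\|_2^2$. -/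
open MeasureTheory Matrix

section

open scoped ComplexOrder

namespace FrameSubsampling

variable {ι : Type*} [Fintype ι]

lemma star_dotProduct_self_eq (u : ι → ℂ) :
    star u ⬝ᵥ u = ((∑ j, ‖u j‖ ^ 2 : ℝ) : ℂ) := by
  simp [dotProduct, Complex.conj_mul']

lemma star_dotProduct_vecMulVec_mulVec (u a : ι → ℂ) :
    star a ⬝ᵥ (vecMulVec u (star u) *ᵥ a) = ((‖star u ⬝ᵥ a‖ ^ 2 : ℝ) : ℂ) := by
  have h : star a ⬝ᵥ u = star (star u ⬝ᵥ a) := star_dotProduct a u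
  rw [vecMulVec_mulVec, dotProduct_smul, h]
  simp [Complex.conj_mul']

lemma norm_star_dotProduct_sq_le (u a : ι → ℂ) :
    ‖star u ⬝ᵥ a‖ ^ 2 ≤ (∑ j, ‖u j‖ ^ 2) * ∑ j, ‖a j‖ ^ 2 := by
  have h := norm_inner_le_norm (𝕜 := ℂ) (WithLp.toLp 2 u) (WithLp.toLp 2 a)
  rw [EuclideanSpace.inner_toLp_toLp, dotProduct_comm] at h
  have h2 := pow_le_pow_left₀ (norm_nonneg _) h 2
  rwa [mul_pow, EuclideanSpace.norm_sq_eq, EuclideanSpace.norm_sq_eq] at h2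

/-- The vector `y` scaled to length one, or zero if `y = 0`. -/
noncomputable def unitVec (y : ι → ℂ) : ι → ℂ :=
  (((√(∑ j, ‖y j‖ ^ 2))⁻¹ : ℝ) : ℂ) • y

lemma sum_norm_unitVec_sq_le (y : ι → ℂ) : ∑ j, ‖unitVec y j‖ ^ 2 ≤ 1 := by
  have h : 0 ≤ ∑ j, ‖y j‖ ^ 2 := by positivity
  simp only [unitVec, Pi.smul_apply, norm_smul, mul_pow, ← Finset.mul_sum, Complex.norm_real,
    Real.norm_eq_abs, sq_abs, inv_pow, Real.sq_sqrt h]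
  exact inv_mul_le_one

lemma norm_star_unitVec_dotProduct_sq (y a : ι → ℂ) :
    ‖star (unitVec y) ⬝ᵥ a‖ ^ 2 = (∑ j, ‖y j‖ ^ 2)⁻¹ * ‖star y ⬝ᵥ a‖ ^ 2 := by
  have h : 0 ≤ ∑ j, ‖y j‖ ^ 2 := by positivity
  rw [unitVec, star_smul, smul_dotProduct, norm_smul, mul_pow, norm_star, Complex.norm_real,
    Real.norm_eq_abs, sq_abs, inv_pow, Real.sq_sqrt h]

lemma sum_norm_sq_mul_norm_star_unitVec_dotProduct_sq (y a : ι → ℂ) :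
    (∑ j, ‖y j‖ ^ 2) * ‖star (unitVec y) ⬝ᵥ a‖ ^ 2 = ‖star y ⬝ᵥ a‖ ^ 2 := by
  rw [norm_star_unitVec_dotProduct_sq]
  rcases eq_or_ne (∑ j, ‖y j‖ ^ 2) 0 with h | h
  · have h1 := norm_star_dotProduct_sq_le y a
    rw [h, zero_mul] at h1
    rw [h, zero_mul]
    exact (sq_nonneg _).antisymm h1
  · exact mul_inv_cancel_left₀ h _

/-- Chebyshev's inequality for the moments of a measure of mass at most one. -/
lemma sum_pow_mul_sum_pow_le (e w : ι → ℝ) (he : ∀ i, 0 ≤ e i) (hw : ∀ i, 0 ≤ w i)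
    (hw1 : ∑ i, w i ≤ 1) (a b : ℕ) :
    (∑ i, e i ^ a * w i) * (∑ i, e i ^ b * w i) ≤ ∑ i, e i ^ (a + b) * w i := by
  have key : 0 ≤ ∑ i, ∑ j, w i * w j * ((e i ^ a - e j ^ a) * (e i ^ b - e j ^ b)) := by
    refine Finset.sum_nonneg fun i _ => Finset.sum_nonneg fun j _ =>
      mul_nonneg (mul_nonneg (hw i) (hw j)) ?_
    rcases le_total (e i) (e j) with h | h
    · exact mul_nonneg_of_nonpos_of_nonpos (sub_nonpos.2 (pow_le_pow_left₀ (he i) h a))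
        (sub_nonpos.2 (pow_le_pow_left₀ (he i) h b))
    · exact mul_nonneg (sub_nonneg.2 (pow_le_pow_left₀ (he j) h a))
        (sub_nonneg.2 (pow_le_pow_left₀ (he j) h b))
  have expand : ∑ i, ∑ j, w i * w j * ((e i ^ a - e j ^ a) * (e i ^ b - e j ^ b)) =
      2 * ((∑ i, w i) * ∑ i, e i ^ (a + b) * w i) -
        2 * ((∑ i, e i ^ a * w i) * ∑ i, e i ^ b * w i) := by
    have h1 : ∑ i, ∑ j, w i * w j * ((e i ^ a - e j ^ a) * (e i ^ b - e j ^ b)) =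
        ∑ i, ∑ j, (e i ^ (a + b) * w i * w j + w i * (e j ^ (a + b) * w j) -
          (e i ^ a * w i * (e j ^ b * w j) + e i ^ b * w i * (e j ^ a * w j))) :=
      Finset.sum_congr rfl fun i _ => Finset.sum_congr rfl fun j _ => by ring
    rw [h1]
    simp only [Finset.sum_sub_distrib, Finset.sum_add_distrib, ← Finset.sum_mul_sum]
    ring
  have hle : (∑ i, w i) * ∑ i, e i ^ (a + b) * w i ≤ ∑ i, e i ^ (a + b) * w i :=
    mul_le_of_le_one_left
      (Finset.sum_nonneg fun i _ => mul_nonneg (pow_nonneg (he i) _) (hw i)) hw1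
  linarith

variable [DecidableEq ι]

/-- Spectral decomposition of the powers of a positive semidefinite matrix. -/
lemma exists_spectral_decomposition {H : Matrix ι ι ℂ} (hH : H.PosSemidef) :
    ∃ (e : ι → ℝ) (v : ι → ι → ℂ), (∀ i, 0 ≤ e i) ∧ (∀ i, ∑ j, ‖v i j‖ ^ 2 = 1) ∧
      (∀ k u, (star u ⬝ᵥ (H ^ k *ᵥ u)).re = ∑ i, e i ^ k * ‖star u ⬝ᵥ v i‖ ^ 2) ∧
      ∀ k, (H ^ k).trace.re = ∑ i, e i ^ k := by
  have hh := hH.isHermitian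
  set U : Matrix ι ι ℂ := (hh.eigenvectorUnitary : Matrix ι ι ℂ)
  have hUU : star U * U = 1 := Unitary.coe_star_mul_self hh.eigenvectorUnitary
  have hpow (k : ℕ) :
      H ^ k = U * diagonal (fun i => ((hh.eigenvalues i ^ k : ℝ) : ℂ)) * star U := by
    conv_lhs => rw [hh.spectral_theorem]
    rw [← map_pow, diagonal_pow, Unitary.conjStarAlgAut_apply]
    congr 3
    ext i
    simp
  refine ⟨hh.eigenvalues, fun i j => U j i, hH.eigenvalues_nonneg, fun i => ?_, fun k u => ?_,
    fun k => ?_⟩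
  · have h := congrFun (congrFun hUU i) i
    rw [star_eq_conjTranspose, mul_apply, one_apply_eq] at h
    have h2 := star_dotProduct_self_eq (fun j => U j i)
    rw [dotProduct] at h2
    simp only [conjTranspose_apply] at h
    exact_mod_cast h2.symm.trans h
  · rw [hpow, ← mulVec_mulVec, ← mulVec_mulVec, dotProduct_mulVec]
    have h1 : star u ᵥ* U = star (star U *ᵥ u) := by
      rw [star_mulVec, star_eq_conjTranspose, conjTranspose_conjTranspose]
    have h2 (i : ι) : star u ⬝ᵥ (fun j => U j i) = star ((star U *ᵥ u) i) := by
      rw [← Pi.star_apply, ← h1]; rfl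
    simp only [h2, norm_star]
    rw [h1, dotProduct, Complex.re_sum]
    refine Finset.sum_congr rfl fun i _ => ?_
    rw [mulVec_diagonal, Pi.star_apply, mul_left_comm, RCLike.star_def, Complex.conj_mul']
    norm_cast
  · rw [hpow, trace_mul_comm, ← mul_assoc, hUU, one_mul, trace_diagonal]
    norm_cast

lemma moment_mul_moment_le {H : Matrix ι ι ℂ} (hH : H.PosSemidef) {u : ι → ℂ}
    (hu : ∑ j, ‖u j‖ ^ 2 ≤ 1) (a b : ℕ) :
    (star u ⬝ᵥ (H ^ a *ᵥ u)).re * (star u ⬝ᵥ (H ^ b *ᵥ u)).re ≤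
      (star u ⬝ᵥ (H ^ (a + b) *ᵥ u)).re := by
  obtain ⟨e, v, he, -, hq, -⟩ := exists_spectral_decomposition hH
  have h0 := hq 0 u
  simp only [pow_zero, one_mulVec, one_mul, star_dotProduct_self_eq, Complex.ofReal_re] at h0
  rw [hq, hq, hq]
  exact sum_pow_mul_sum_pow_le e _ he (fun i => by positivity) (h0 ▸ hu) a b

lemma moment_nonneg {H : Matrix ι ι ℂ} (hH : H.PosSemidef) (u : ι → ℂ) (k : ℕ) :
    0 ≤ (star u ⬝ᵥ (H ^ k *ᵥ u)).re := by
  obtain ⟨e, v, he, -, hq, -⟩ := exists_spectral_decomposition hH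
  rw [hq]
  exact Finset.sum_nonneg fun i _ => mul_nonneg (pow_nonneg (he i) _) (sq_nonneg _)

section Derivative

open scoped Matrix.Norms.Operator

lemma hasDerivAt_pow_add_smul (H P : Matrix ι ι ℂ) (k : ℕ) (s : ℝ) :
    HasDerivAt (fun s : ℝ => (H + s • P) ^ k)
      (∑ i ∈ Finset.range k, (H + s • P) ^ (k - 1 - i) * P * (H + s • P) ^ i) s := by
  have h : HasDerivAt (fun s : ℝ => H + s • P) P s := by
    exact (((hasDerivAt_id s).smul_const P).const_add H).congr_deriv (one_smul ℝ P)
  exact h.fun_pow' k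

lemma hasDerivAt_linearMap_comp_pow (L : Matrix ι ι ℂ →ₗ[ℝ] ℝ) (H P : Matrix ι ι ℂ)
    (k : ℕ) (s : ℝ) :
    HasDerivAt (fun s : ℝ => L ((H + s • P) ^ k))
      (∑ i ∈ Finset.range k, L ((H + s • P) ^ (k - 1 - i) * P * (H + s • P) ^ i)) s := by
  have h := (LinearMap.toContinuousLinearMap L).hasFDerivAt.comp_hasDerivAt s
    (hasDerivAt_pow_add_smul H P k s)
  exact h.congr_deriv (map_sum L _ _)

end Derivative

lemma hasDerivAt_trace_pow (H : Matrix ι ι ℂ) (u : ι → ℂ) (k : ℕ) (s : ℝ) :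
    HasDerivAt (fun s : ℝ => ((H + s • vecMulVec u (star u)) ^ (k + 1)).trace.re)
      ((k + 1) * (star u ⬝ᵥ ((H + s • vecMulVec u (star u)) ^ k *ᵥ u)).re) s := by
  have h := hasDerivAt_linearMap_comp_pow
    (Complex.reLm ∘ₗ (traceLinearMap ι ℝ ℂ)) H (vecMulVec u (star u)) (k + 1) s
  refine HasDerivAt.congr_deriv h ?_
  have hi : ∀ i ∈ Finset.range (k + 1), (Complex.reLm ∘ₗ (traceLinearMap ι ℝ ℂ))
      ((H + s • vecMulVec u (star u)) ^ (k + 1 - 1 - i) * vecMulVec u (star u) *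
        (H + s • vecMulVec u (star u)) ^ i) =
      (star u ⬝ᵥ ((H + s • vecMulVec u (star u)) ^ k *ᵥ u)).re := by
    intro i hi
    have hik : i + (k + 1 - 1 - i) = k := by have := Finset.mem_range.1 hi; omega
    simp only [LinearMap.comp_apply, traceLinearMap_apply, Complex.reLm_coe]
    rw [trace_mul_comm, ← mul_assoc, ← pow_add, hik, mul_vecMulVec, trace_vecMulVec,
      dotProduct_comm]
  rw [Finset.sum_congr rfl hi]
  simp

lemma hasDerivAt_moment (H : Matrix ι ι ℂ) (u : ι → ℂ) (k : ℕ) (s : ℝ) :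
    HasDerivAt (fun s : ℝ => (star u ⬝ᵥ ((H + s • vecMulVec u (star u)) ^ k *ᵥ u)).re)
      (∑ i ∈ Finset.range k,
        (star u ⬝ᵥ ((H + s • vecMulVec u (star u)) ^ (k - 1 - i) *ᵥ u) *
          (star u ⬝ᵥ ((H + s • vecMulVec u (star u)) ^ i *ᵥ u))).re) s := by
  let L : Matrix ι ι ℂ →ₗ[ℝ] ℝ :=
    { toFun := fun X => (star u ⬝ᵥ (X *ᵥ u)).re
      map_add' := fun X Y => by simp [add_mulVec, dotProduct_add]
      map_smul' := fun c X => by simp [smul_mulVec, dotProduct_smul] }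
  refine HasDerivAt.congr_deriv
    (hasDerivAt_linearMap_comp_pow L H (vecMulVec u (star u)) k s) ?_
  refine Finset.sum_congr rfl fun i _ => ?_
  change (star u ⬝ᵥ (((H + s • vecMulVec u (star u)) ^ (k - 1 - i) * vecMulVec u (star u) *
    (H + s • vecMulVec u (star u)) ^ i) *ᵥ u)).re = _
  rw [← mulVec_mulVec, ← mulVec_mulVec, vecMulVec_mulVec, mulVec_smul, dotProduct_smul]
  simp [mul_comm]

lemma moment_im {H : Matrix ι ι ℂ} (hH : H.IsHermitian) (u : ι → ℂ) (k : ℕ) :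
    (star u ⬝ᵥ (H ^ k *ᵥ u)).im = 0 :=
  (hH.pow k).im_star_dotProduct_mulVec_self u

/-- Truncated exponential of the quadratic form at `u`. -/
noncomputable def expMoment (D : ℕ) (u : ι → ℂ) (H : Matrix ι ι ℂ) : ℝ :=
  ∑ k ∈ Finset.range D, (k.factorial : ℝ)⁻¹ * (star u ⬝ᵥ (H ^ k *ᵥ u)).re

/-- Trace of the truncated exponential. -/
noncomputable def expTrace (D : ℕ) (H : Matrix ι ι ℂ) : ℝ :=
  ∑ k ∈ Finset.range D, (k.factorial : ℝ)⁻¹ * (H ^ k).trace.re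

lemma hasDerivAt_expTrace (H : Matrix ι ι ℂ) (u : ι → ℂ) (D : ℕ) (s : ℝ) :
    HasDerivAt (fun s : ℝ => expTrace (D + 1) (H + s • vecMulVec u (star u)))
      (expMoment D u (H + s • vecMulVec u (star u))) s := by
  simp only [expTrace, Finset.sum_range_succ']
  rw [show expMoment D u (H + s • vecMulVec u (star u)) = ∑ k ∈ Finset.range D,
      ((k + 1).factorial : ℝ)⁻¹ *
        ((k + 1) * (star u ⬝ᵥ ((H + s • vecMulVec u (star u)) ^ k *ᵥ u)).re) by
    refine Finset.sum_congr rfl fun k _ => ?_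
    rw [Nat.factorial_succ]
    push_cast
    field_simp]
  simp only [pow_zero]
  exact (HasDerivAt.fun_sum fun k _ => (hasDerivAt_trace_pow H u k s).const_mul _).add_const _

lemma exists_hasDerivAt_expMoment {H : Matrix ι ι ℂ} {u : ι → ℂ}
    (hu : ∑ j, ‖u j‖ ^ 2 ≤ 1) (D : ℕ) (s : ℝ) :
    ∃ d, HasDerivAt (fun s : ℝ => expMoment D u (H + s • vecMulVec u (star u))) d s ∧
      ((H + s • vecMulVec u (star u)).PosSemidef →
        d ≤ expMoment D u (H + s • vecMulVec u (star u))) := by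
  refine ⟨_, HasDerivAt.fun_sum fun k _ => (hasDerivAt_moment H u k s).const_mul _, fun hK => ?_⟩
  set K := H + s • vecMulVec u (star u)
  rcases D with _ | D
  · simp [expMoment]
  rw [Finset.sum_range_succ']
  have hle : expMoment D u K ≤ expMoment (D + 1) u K := by
    rw [expMoment, expMoment, Finset.sum_range_succ]
    exact le_add_of_nonneg_right (mul_nonneg (by positivity) (moment_nonneg hK u D))
  refine le_trans ?_ hle
  simp only [Finset.range_zero, Finset.sum_empty, mul_zero, add_zero]
  refine Finset.sum_le_sum fun k _ => ?_
  have hk : ∑ i ∈ Finset.range (k + 1),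
      (star u ⬝ᵥ (K ^ (k + 1 - 1 - i) *ᵥ u) * (star u ⬝ᵥ (K ^ i *ᵥ u))).re ≤
      ∑ i ∈ Finset.range (k + 1), (star u ⬝ᵥ (K ^ k *ᵥ u)).re := by
    refine Finset.sum_le_sum fun i hi => ?_
    have hik : k + 1 - 1 - i + i = k := by have := Finset.mem_range.1 hi; omega
    rw [Complex.mul_re, moment_im hK.isHermitian, zero_mul, sub_zero]
    exact (moment_mul_moment_le hK hu _ _).trans_eq (by rw [hik])
  calc _ ≤ ((k + 1).factorial : ℝ)⁻¹ *
        ∑ i ∈ Finset.range (k + 1), (star u ⬝ᵥ (K ^ k *ᵥ u)).re := by gcongr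
    _ = _ := by
      rw [Finset.sum_const, Finset.card_range, Nat.factorial_succ]
      push_cast
      rw [nsmul_eq_mul]
      push_cast
      field_simp

lemma convex_setOf_posSemidef {κ : Type*} (H P : Matrix κ κ ℂ) :
    Convex ℝ {s : ℝ | (H + s • P).PosSemidef} := by
  intro s hs t ht a b ha hb hab
  have h : H + (a • s + b • t) • P = a • (H + s • P) + b • (H + t • P) := by
    have h1 : H = a • H + b • H := by rw [← add_smul, hab, one_smul]
    conv_lhs => rw [h1]
    simp only [smul_eq_mul, smul_add, add_smul, mul_smul]
    abel
  change (H + (a • s + b • t) • P).PosSemidef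
  rw [h]
  exact (hs.smul ha).add (ht.smul hb)

/-- A truncated Golden–Thompson inequality for rank-one perturbations. -/
lemma expTrace_add_smul_vecMulVec_le {H : Matrix ι ι ℂ} {u : ι → ℂ}
    (hu : ∑ j, ‖u j‖ ^ 2 ≤ 1) (hH : H.PosSemidef) {c : ℝ}
    (hHc : (H + c • vecMulVec u (star u)).PosSemidef) (D : ℕ) :
    expTrace (D + 1) (H + c • vecMulVec u (star u)) ≤
      expTrace (D + 1) H + (Real.exp c - 1) * expMoment D u H := by
  set P := vecMulVec u (star u)
  set I : Set ℝ := {s | (H + s • P).PosSemidef} with hI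
  have hconv : Convex ℝ I := convex_setOf_posSemidef H P
  have h0 : (0 : ℝ) ∈ I := by simpa [hI] using hH
  have hanti : AntitoneOn (fun s : ℝ => Real.exp (-s) * expMoment D u (H + s • P)) I := by
    choose d hd hd' using exists_hasDerivAt_expMoment (H := H) hu D
    have hder (s : ℝ) : HasDerivAt (fun s : ℝ => Real.exp (-s) * expMoment D u (H + s • P))
        (Real.exp (-s) * (d s - expMoment D u (H + s • P))) s := by
      refine ((hasDerivAt_neg s).exp.mul (hd s)).congr_deriv ?_
      ring
    refine antitoneOn_of_deriv_nonpos hconv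
      (fun s _ => (hder s).continuousAt.continuousWithinAt)
      (fun s _ => (hder s).differentiableAt.differentiableWithinAt) fun s hs => ?_
    rw [(hder s).deriv]
    exact mul_nonpos_of_nonneg_of_nonpos (Real.exp_pos _).le
      (sub_nonpos.2 (hd' s (show s ∈ I from interior_subset hs)))
  have hexp (s x y : ℝ) : Real.exp (-s) * x ≤ y ↔ x ≤ Real.exp s * y := by
    rw [Real.exp_neg, inv_mul_le_iff₀ (Real.exp_pos s)]
  set G : ℝ → ℝ := fun s => expTrace (D + 1) (H + s • P) - Real.exp s * expMoment D u H with hG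
  have hder (s : ℝ) : HasDerivAt G
      (expMoment D u (H + s • P) - Real.exp s * expMoment D u H) s :=
    (hasDerivAt_expTrace H u D s).sub ((Real.hasDerivAt_exp s).mul_const _)
  suffices h : G c ≤ G 0 by
    simp only [hG, zero_smul, add_zero, Real.exp_zero] at h
    linarith
  rcases le_total 0 c with hc | hc
  · refine antitoneOn_of_deriv_nonpos (hconv.inter (convex_Ici 0))
      (fun s _ => (hder s).continuousAt.continuousWithinAt)
      (fun s _ => (hder s).differentiableAt.differentiableWithinAt) (fun s hs => ?_)
      ⟨h0, Set.self_mem_Ici⟩ ⟨hHc, hc⟩ hc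
    rw [(hder s).deriv, sub_nonpos, ← hexp]
    simpa using hanti h0 (interior_subset hs).1 (interior_subset hs).2
  · refine monotoneOn_of_deriv_nonneg (hconv.inter (convex_Iic 0))
      (fun s _ => (hder s).continuousAt.continuousWithinAt)
      (fun s _ => (hder s).differentiableAt.differentiableWithinAt) (fun s hs => ?_)
      ⟨hHc, hc⟩ ⟨h0, Set.self_mem_Iic⟩ hc
    rw [(hder s).deriv, sub_nonneg]
    have := hanti (interior_subset hs).1 h0 (interior_subset hs).2
    simp only [zero_smul, add_zero, neg_zero, Real.exp_zero, one_mul, Real.exp_neg] at this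
    rwa [le_inv_mul_iff₀ (Real.exp_pos s)] at this

/-- The trace of the exponential of a matrix. -/
noncomputable def traceExp (H : Matrix ι ι ℂ) : ℝ :=
  ∑' k : ℕ, (k.factorial : ℝ)⁻¹ * (H ^ k).trace.re

lemma hasSum_inv_factorial_mul_sum_pow_mul {κ : Type*} [Fintype κ] (e w : κ → ℝ) :
    HasSum (fun k : ℕ => (k.factorial : ℝ)⁻¹ * ∑ i, e i ^ k * w i)
      (∑ i, Real.exp (e i) * w i) := by
  have h (i : κ) : HasSum (fun k : ℕ => (k.factorial : ℝ)⁻¹ * (e i ^ k * w i))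
      (Real.exp (e i) * w i) := by
    have h1 := (NormedSpace.expSeries_div_hasSum_exp (e i)).mul_right (w i)
    rw [← Real.exp_eq_exp_ℝ] at h1
    simpa only [div_eq_inv_mul, mul_assoc] using h1
  simpa only [Finset.mul_sum] using hasSum_sum fun i _ => h i

/-- Spectral decomposition of the exponential of a positive semidefinite matrix. -/
lemma exists_spectral_decomposition_exp {H : Matrix ι ι ℂ} (hH : H.PosSemidef) :
    ∃ (e : ι → ℝ) (v : ι → ι → ℂ), (∀ i, ∑ j, ‖v i j‖ ^ 2 = 1) ∧
      (∀ u, (star u ⬝ᵥ (H *ᵥ u)).re = ∑ i, e i * ‖star u ⬝ᵥ v i‖ ^ 2) ∧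
      (∀ u, ∑ j, ‖u j‖ ^ 2 = ∑ i, ‖star u ⬝ᵥ v i‖ ^ 2) ∧
      (∀ u, Filter.Tendsto (fun D => expMoment D u H) Filter.atTop
        (nhds (∑ i, Real.exp (e i) * ‖star u ⬝ᵥ v i‖ ^ 2))) ∧
      Filter.Tendsto (fun D => expTrace D H) Filter.atTop (nhds (traceExp H)) ∧
      traceExp H = ∑ i, Real.exp (e i) := by
  obtain ⟨e, v, -, hv, hq, htr⟩ := exists_spectral_decomposition hH
  have htrace : HasSum (fun k : ℕ => (k.factorial : ℝ)⁻¹ * (H ^ k).trace.re)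
      (∑ i, Real.exp (e i)) := by
    simpa [htr] using hasSum_inv_factorial_mul_sum_pow_mul e 1
  refine ⟨e, v, hv, fun u => ?_, fun u => ?_, fun u => ?_, ?_, htrace.tsum_eq⟩
  · simpa using hq 1 u
  · simpa [star_dotProduct_self_eq, -Complex.ofReal_sum] using hq 0 u
  · simp only [expMoment, hq]
    exact (hasSum_inv_factorial_mul_sum_pow_mul e _).tendsto_sum_nat
  · exact htrace.summable.hasSum.tendsto_sum_nat

lemma traceExp_nonneg {H : Matrix ι ι ℂ} (hH : H.PosSemidef) : 0 ≤ traceExp H := by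
  obtain ⟨e, v, -, -, -, -, -, h⟩ := exists_spectral_decomposition_exp hH
  rw [h]
  positivity

lemma traceExp_smul_one (b : ℝ) :
    traceExp (b • (1 : Matrix ι ι ℂ)) = Fintype.card ι * Real.exp b := by
  have h := hasSum_inv_factorial_mul_sum_pow_mul (fun _ : ι => b) 1
  rw [traceExp]
  refine Eq.trans (tsum_congr fun k => ?_) (h.tsum_eq.trans ?_)
  · rw [smul_pow, one_pow, trace_smul, trace_one, Complex.smul_re, Complex.natCast_re]
    simp [mul_comm]
  · simp

lemma exp_le_traceExp {H : Matrix ι ι ℂ} (hH : H.PosSemidef) {τ : ℝ} {a : ι → ℂ}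
    (ha : τ * ∑ j, ‖a j‖ ^ 2 < (star a ⬝ᵥ (H *ᵥ a)).re) : Real.exp τ ≤ traceExp H := by
  obtain ⟨e, v, -, hq, hn, -, -, h⟩ := exists_spectral_decomposition_exp hH
  rw [hq, hn, Finset.mul_sum] at ha
  obtain ⟨i, -, hi⟩ := Finset.exists_lt_of_sum_lt ha
  have hτ : τ ≤ e i := (lt_of_mul_lt_mul_right hi (sq_nonneg _)).le
  rw [h]
  exact (Real.exp_le_exp.2 hτ).trans
    (Finset.single_le_sum (f := fun i => Real.exp (e i)) (fun i _ => (Real.exp_pos _).le)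
      (Finset.mem_univ i))

lemma pi_real_finset {κ : Type*} {n : ℕ} [MeasurableSpace κ] [MeasurableSingletonClass κ] {ρ : κ → ℝ}
    (hρ : ∀ i, 0 ≤ ρ i) {μ : Measure κ} [IsProbabilityMeasure μ]
    (hμ : ∀ i, μ {i} = ENNReal.ofReal (ρ i)) (s : Finset (Fin n → κ)) :
    (Measure.pi fun _ : Fin n => μ).real s = ∑ j ∈ s, ∏ k, ρ (j k) := by
  rw [← sum_measureReal_singleton]
  refine Finset.sum_congr rfl fun j _ => ?_
  rw [measureReal_def, Measure.pi_singleton, ENNReal.toReal_prod]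
  exact Finset.prod_congr rfl fun k _ => by rw [hμ, ENNReal.toReal_ofReal (hρ _)]

variable {κ : Type*} [Fintype κ]

/-- One step of the matrix Laplace transform method. -/
lemma sum_mul_traceExp_add_le {ρ : κ → ℝ} (hρ : ∀ i, 0 ≤ ρ i) (hρ1 : ∑ i, ρ i = 1)
    {u : κ → ι → ℂ} (hu : ∀ i, ∑ j, ‖u i j‖ ^ 2 ≤ 1) {c β : ℝ}
    (hβ : ∀ x : ι → ℂ, (Real.exp c - 1) * ∑ i, ρ i * ‖star (u i) ⬝ᵥ x‖ ^ 2 ≤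
      (Real.exp c - 1) * β * ∑ j, ‖x j‖ ^ 2)
    {H : Matrix ι ι ℂ} (hH : H.PosSemidef)
    (hHc : ∀ i, (H + c • vecMulVec (u i) (star (u i))).PosSemidef) :
    ∑ i, ρ i * traceExp (H + c • vecMulVec (u i) (star (u i))) ≤
      Real.exp ((Real.exp c - 1) * β) * traceExp H := by
  obtain ⟨e, v, hv, -, -, hq, htr, h⟩ := exists_spectral_decomposition_exp hH
  have hgt (i : κ) : traceExp (H + c • vecMulVec (u i) (star (u i))) ≤
      traceExp H + (Real.exp c - 1) * ∑ l, Real.exp (e l) * ‖star (u i) ⬝ᵥ v l‖ ^ 2 := by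
    obtain ⟨-, -, -, -, -, -, htr', -⟩ := exists_spectral_decomposition_exp (hHc i)
    exact le_of_tendsto_of_tendsto' (htr'.comp (Filter.tendsto_add_atTop_nat 1))
      ((htr.comp (Filter.tendsto_add_atTop_nat 1)).add ((hq (u i)).const_mul _))
      fun D => expTrace_add_smul_vecMulVec_le (hu i) hH (hHc i) D
  calc ∑ i, ρ i * traceExp (H + c • vecMulVec (u i) (star (u i)))
      ≤ ∑ i, ρ i * (traceExp H +
          (Real.exp c - 1) * ∑ l, Real.exp (e l) * ‖star (u i) ⬝ᵥ v l‖ ^ 2) :=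
        Finset.sum_le_sum fun i _ => mul_le_mul_of_nonneg_left (hgt i) (hρ i)
    _ = traceExp H + ∑ l, Real.exp (e l) *
          ((Real.exp c - 1) * ∑ i, ρ i * ‖star (u i) ⬝ᵥ v l‖ ^ 2) := by
        simp only [mul_add, Finset.sum_add_distrib, ← Finset.sum_mul, hρ1, one_mul,
          Finset.mul_sum]
        rw [Finset.sum_comm]
        congr 1
        exact Finset.sum_congr rfl fun l _ => Finset.sum_congr rfl fun i _ => by ring
    _ ≤ traceExp H + ∑ l, Real.exp (e l) * ((Real.exp c - 1) * β) := by
        refine add_le_add_right (Finset.sum_le_sum fun l _ =>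
          mul_le_mul_of_nonneg_left ?_ (Real.exp_pos _).le) _
        simpa only [hv, mul_one] using hβ (v l)
    _ = ((Real.exp c - 1) * β + 1) * traceExp H := by
        rw [← Finset.sum_mul, ← h]
        ring
    _ ≤ _ := mul_le_mul_of_nonneg_right (Real.add_one_le_exp _) (traceExp_nonneg hH)

/-- The matrix Laplace transform of a sum of independent rank-one matrices. -/
lemma sum_prod_mul_traceExp_le {ρ : κ → ℝ} (hρ : ∀ i, 0 ≤ ρ i) (hρ1 : ∑ i, ρ i = 1)
    {u : κ → ι → ℂ} (hu : ∀ i, ∑ j, ‖u i j‖ ^ 2 ≤ 1) {b c β : ℝ} (hb : 0 ≤ b)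
    (hbc : ∀ i, (b • (1 : Matrix ι ι ℂ) + c • vecMulVec (u i) (star (u i))).PosSemidef)
    (hβ : ∀ x : ι → ℂ, (Real.exp c - 1) * ∑ i, ρ i * ‖star (u i) ⬝ᵥ x‖ ^ 2 ≤
      (Real.exp c - 1) * β * ∑ j, ‖x j‖ ^ 2) (n : ℕ) (H : Matrix ι ι ℂ)
    (hH : (H - (n * b) • (1 : Matrix ι ι ℂ)).PosSemidef) :
    ∑ j : Fin n → κ, (∏ k, ρ (j k)) *
        traceExp (H + ∑ k, c • vecMulVec (u (j k)) (star (u (j k)))) ≤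
      Real.exp ((Real.exp c - 1) * β) ^ n * traceExp H := by
  induction n generalizing H with
  | zero => simp
  | succ n ih =>
    have hone {r : ℝ} (hr : 0 ≤ r) : (r • (1 : Matrix ι ι ℂ)).PosSemidef :=
      PosSemidef.one.smul hr
    have hHc (i : κ) : (H + c • vecMulVec (u i) (star (u i)) -
        (n * b) • (1 : Matrix ι ι ℂ)).PosSemidef := by
      have h := hH.add (hbc i)
      convert h using 1
      push_cast
      rw [add_mul, one_mul, add_smul]
      abel
    have hPSD {K : Matrix ι ι ℂ} {l : ℕ} (hK : (K - (l * b) • (1 : Matrix ι ι ℂ)).PosSemidef) :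
        K.PosSemidef := by
      simpa using hK.add (hone (by positivity : (0 : ℝ) ≤ l * b))
    rw [← (Fin.consEquiv fun _ => κ).sum_comp, Fintype.sum_prod_type]
    simp only [Fin.consEquiv_apply, Fin.prod_univ_succ, Fin.sum_univ_succ, Fin.cons_zero,
      Fin.cons_succ, mul_assoc, ← add_assoc, ← Finset.mul_sum]
    calc _ ≤ ∑ i, ρ i * (Real.exp ((Real.exp c - 1) * β) ^ n *
            traceExp (H + c • vecMulVec (u i) (star (u i)))) :=
          Finset.sum_le_sum fun i _ => mul_le_mul_of_nonneg_left (ih _ (hHc i)) (hρ i)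
      _ = Real.exp ((Real.exp c - 1) * β) ^ n *
            ∑ i, ρ i * traceExp (H + c • vecMulVec (u i) (star (u i))) := by
          rw [Finset.mul_sum]
          exact Finset.sum_congr rfl fun i _ => by ring
      _ ≤ Real.exp ((Real.exp c - 1) * β) ^ n *
            (Real.exp ((Real.exp c - 1) * β) * traceExp H) := by
          gcongr
          exact sum_mul_traceExp_add_le hρ hρ1 hu hβ (hPSD hH) fun i => hPSD (hHc i)
      _ = _ := by ring

lemma posSemidef_smul_one_add_smul_vecMulVec {u : ι → ℂ} (hu : ∑ j, ‖u j‖ ^ 2 ≤ 1) {b c : ℝ}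
    (hb : 0 ≤ b) (hbc : 0 ≤ b + c) :
    (b • (1 : Matrix ι ι ℂ) + c • vecMulVec u (star u)).PosSemidef := by
  have hP : (vecMulVec u (star u)).IsHermitian := (posSemidef_vecMulVec_self_star u).isHermitian
  refine PosSemidef.of_dotProduct_mulVec_nonneg ?_ fun x => ?_
  · refine IsHermitian.add ?_ ?_
    · simp [IsHermitian, conjTranspose_smul]
    · simp [IsHermitian, conjTranspose_smul, hP.eq]
  · rw [add_mulVec, smul_mulVec, smul_mulVec, one_mulVec, dotProduct_add, dotProduct_smul,
      dotProduct_smul, star_dotProduct_self_eq, star_dotProduct_vecMulVec_mulVec]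
    have h1 := norm_star_dotProduct_sq_le u x
    have h2 : (∑ j, ‖u j‖ ^ 2) * ∑ j, ‖x j‖ ^ 2 ≤ ∑ j, ‖x j‖ ^ 2 :=
      mul_le_of_le_one_left (by positivity) hu
    have h3 : 0 ≤ b * ∑ j, ‖x j‖ ^ 2 + c * ‖star u ⬝ᵥ x‖ ^ 2 := by
      nlinarith [sq_nonneg ‖star u ⬝ᵥ x‖]
    rw [Complex.real_smul, Complex.real_smul]
    exact_mod_cast h3

open Classical in
/-- Matrix Chernoff tail bound for a sum of independent rank-one matrices; a negative `c` gives the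
lower tail. -/
lemma sum_prod_tail_le {ρ : κ → ℝ} (hρ : ∀ i, 0 ≤ ρ i) (hρ1 : ∑ i, ρ i = 1)
    {u : κ → ι → ℂ} (hu : ∀ i, ∑ j, ‖u i j‖ ^ 2 ≤ 1) {c β : ℝ}
    (hβ : ∀ x : ι → ℂ, (Real.exp c - 1) * ∑ i, ρ i * ‖star (u i) ⬝ᵥ x‖ ^ 2 ≤
      (Real.exp c - 1) * β * ∑ j, ‖x j‖ ^ 2) (n : ℕ) (σ : ℝ) :
    ∑ j : Fin n → κ with ∃ a : ι → ℂ, σ * ∑ l, ‖a l‖ ^ 2 <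
        c * ∑ k, ‖star (u (j k)) ⬝ᵥ a‖ ^ 2, ∏ k, ρ (j k) ≤
      Fintype.card ι * Real.exp (n * ((Real.exp c - 1) * β) - σ) := by
  set b : ℝ := max (-c) 0
  have hb : 0 ≤ b := le_max_right _ _
  have hbc : 0 ≤ b + c := by linarith [le_max_left (-c) 0]
  have hbP (i : κ) := posSemidef_smul_one_add_smul_vecMulVec (hu i) hb hbc
  have hmain := sum_prod_mul_traceExp_le hρ hρ1 hu hb hbP hβ n ((n * b) • 1)
    (by simpa using PosSemidef.zero)
  rw [traceExp_smul_one] at hmain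
  have hK (j : Fin n → κ) : (n * b) • (1 : Matrix ι ι ℂ) +
      ∑ k, c • vecMulVec (u (j k)) (star (u (j k))) =
      ∑ k, (b • (1 : Matrix ι ι ℂ) + c • vecMulVec (u (j k)) (star (u (j k)))) := by
    simp [Finset.sum_add_distrib, mul_smul, Nat.cast_smul_eq_nsmul]
  have hKP (j : Fin n → κ) : ((n * b) • (1 : Matrix ι ι ℂ) +
      ∑ k, c • vecMulVec (u (j k)) (star (u (j k)))).PosSemidef :=
    hK j ▸ posSemidef_sum _ fun k _ => hbP (j k)
  have hprod (j : Fin n → κ) : 0 ≤ ∏ k, ρ (j k) := Finset.prod_nonneg fun k _ => hρ _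
  have hbad (j : Fin n → κ) (hj : ∃ a : ι → ℂ, σ * ∑ l, ‖a l‖ ^ 2 <
      c * ∑ k, ‖star (u (j k)) ⬝ᵥ a‖ ^ 2) : Real.exp (n * b + σ) ≤
      traceExp ((n * b) • (1 : Matrix ι ι ℂ) +
        ∑ k, c • vecMulVec (u (j k)) (star (u (j k)))) := by
    obtain ⟨a, ha⟩ := hj
    refine exp_le_traceExp (hKP j) (a := a) ?_
    have : (star a ⬝ᵥ (((n * b) • (1 : Matrix ι ι ℂ) +
        ∑ k, c • vecMulVec (u (j k)) (star (u (j k)))) *ᵥ a)).re =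
        n * b * ∑ l, ‖a l‖ ^ 2 + c * ∑ k, ‖star (u (j k)) ⬝ᵥ a‖ ^ 2 := by
      rw [add_mulVec, smul_mulVec, one_mulVec, sum_mulVec, dotProduct_add, dotProduct_sum,
        dotProduct_smul, star_dotProduct_self_eq]
      simp only [smul_mulVec, dotProduct_smul, star_dotProduct_vecMulVec_mulVec]
      rw [Complex.add_re, Complex.re_sum, Finset.mul_sum Finset.univ _ c]
      simp only [Complex.smul_re, Complex.ofReal_re, smul_eq_mul]
    rw [this]
    linarith
  have hmarkov : (∑ j : Fin n → κ with ∃ a : ι → ℂ, σ * ∑ l, ‖a l‖ ^ 2 <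
      c * ∑ k, ‖star (u (j k)) ⬝ᵥ a‖ ^ 2, ∏ k, ρ (j k)) * Real.exp (n * b + σ) ≤
      Real.exp ((Real.exp c - 1) * β) ^ n * (Fintype.card ι * Real.exp (n * b)) := by
    refine le_trans ?_ hmain
    rw [Finset.sum_mul]
    refine (Finset.sum_le_sum fun j hj => mul_le_mul_of_nonneg_left
      (hbad j (Finset.mem_filter.1 hj).2) (hprod j)).trans ?_
    exact Finset.sum_le_sum_of_subset_of_nonneg (Finset.filter_subset _ _)
      fun j _ _ => mul_nonneg (hprod j) (traceExp_nonneg (hKP j))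
  rw [← le_div_iff₀ (Real.exp_pos _)] at hmarkov
  refine hmarkov.trans_eq ?_
  rw [← Real.exp_nat_mul, div_eq_iff (Real.exp_pos _).ne', mul_assoc, ← Real.exp_add,
    mul_left_comm, ← Real.exp_add]
  ring_nf

lemma exp_neg_sub_one_add_le {t : ℝ} (ht : 0 ≤ t) :
    Real.exp (-t) - 1 + t * (1 - t) ≤ -(t ^ 2 / 2) := by
  have h := Real.quadratic_le_exp_of_nonneg ht
  have h2 : Real.exp (-t) ≤ 1 - t + t ^ 2 / 2 := by
    rw [Real.exp_neg, inv_le_iff_one_le_mul₀ (Real.exp_pos t)]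
    have h3 : 0 < 1 - t + t ^ 2 / 2 := by nlinarith [sq_nonneg (t - 1)]
    nlinarith [mul_le_mul_of_nonneg_left h h3.le, pow_nonneg ht 4]
  linarith

lemma sub_mul_log_one_add_le {t : ℝ} (ht : 0 < t) (ht1 : t < 1) :
    t - Real.log (1 + t) * (1 + t) ≤ -(t ^ 2 / 3) := by
  have h := Real.le_log_one_add_of_nonneg ht.le
  have h2 : t + t ^ 2 / 3 ≤ 2 * t / (t + 2) * (1 + t) := by
    rw [div_mul_eq_mul_div, le_div_iff₀ (by linarith)]
    nlinarith [mul_pos ht ht, mul_pos (mul_pos ht ht) (sub_pos.2 ht1)]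
  nlinarith [mul_le_mul_of_nonneg_right h (by linarith : (0 : ℝ) ≤ 1 + t)]

/-- The total energy of a Bessel sequence is at most the dimension times the Bessel bound. -/
lemma sum_sum_norm_sq_le {y : κ → ι → ℂ} {B : ℝ}
    (h : ∀ x : ι → ℂ, ∑ i, ‖star (y i) ⬝ᵥ x‖ ^ 2 ≤ B * ∑ j, ‖x j‖ ^ 2) :
    ∑ i, ∑ j, ‖y i j‖ ^ 2 ≤ Fintype.card ι * B := by
  rw [Finset.sum_comm, ← nsmul_eq_mul, ← Finset.card_univ]
  refine Finset.sum_le_card_nsmul _ _ _ fun j _ => ?_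
  have hj := h (Pi.single j 1)
  have h1 : ∑ l, ‖(Pi.single j 1 : ι → ℂ) l‖ ^ 2 = 1 := by
    rw [Finset.sum_eq_single j] <;> simp +contextual
  rw [h1, mul_one] at hj
  simpa using hj

lemma mul_exp_le_half {m p x : ℝ} (hm : 0 < m) (hp : 0 < p) (hx : x ≤ -Real.log (2 * m / p)) :
    m * Real.exp x ≤ p / 2 := by
  have h := Real.exp_le_exp.2 hx
  rw [Real.exp_neg, Real.exp_log (by positivity), inv_div] at h
  calc m * Real.exp x ≤ m * (p / (2 * m)) := by gcongr
    _ = p / 2 := by field_simp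

lemma mul_exp_lt_half {m p x : ℝ} (hm : 0 < m) (hp : 0 < p) (hx : x < -Real.log (2 * m / p)) :
    m * Real.exp x < p / 2 :=
  (mul_lt_mul_of_pos_left (Real.exp_lt_exp.2 hx) hm).trans_le (mul_exp_le_half hm hp le_rfl)

end FrameSubsampling

end

open FrameSubsampling in
/-- Random weighted subsampling of finite frames (Theorem 2.1 / thm:frame_sub). -/
theorem stmt_0 (m M : ℕ) (y : Fin M → Fin m → ℂ) (A B : ℝ)
    (hA : 0 < A) (hAB : A ≤ B)
    (hframe : ∀ x : Fin m → ℂ,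
      A * ∑ j, ‖x j‖ ^ 2 ≤ ∑ i, ‖star (y i) ⬝ᵥ x‖ ^ 2 ∧
      ∑ i, ‖star (y i) ⬝ᵥ x‖ ^ 2 ≤ B * ∑ j, ‖x j‖ ^ 2)
    (p t : ℝ) (hp : 0 < p) (hp1 : p < 1) (ht : 0 < t) (ht1 : t < 1)
    (n : ℕ)
    (hn : 3 * B / (A * t ^ 2) * m * Real.log (2 * m / p) ≤ (n : ℝ))
    (ρ : Fin M → ℝ)
    (hρ : ∀ i, ρ i = (∑ j, ‖y i j‖ ^ 2) / ∑ k, ∑ j, ‖y k j‖ ^ 2)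
    (μ : Measure (Fin M)) [IsProbabilityMeasure μ]
    (hμ : ∀ i, μ {i} = ENNReal.ofReal (ρ i)) :
    ENNReal.ofReal (1 - p) <
      Measure.pi (fun _ : Fin n => μ)
        {j : Fin n → Fin M | ∀ a : Fin m → ℂ,
          (1 - t) * A * ∑ jj, ‖a jj‖ ^ 2 ≤
            (1 / n) * ∑ k, (ρ (j k))⁻¹ * ‖star (y (j k)) ⬝ᵥ a‖ ^ 2 ∧
          (1 / n) * ∑ k, (ρ (j k))⁻¹ * ‖star (y (j k)) ⬝ᵥ a‖ ^ 2 ≤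
            (1 + t) * B * ∑ jj, ‖a jj‖ ^ 2} := by
  classical
  set S : ℝ := ∑ k, ∑ j, ‖y k j‖ ^ 2
  have hB : 0 < B := hA.trans_le hAB
  have hρ0 (i : Fin M) : 0 ≤ ρ i := by rw [hρ]; positivity
  have hρ1 : ∑ i, ρ i = 1 := by
    have h : ∑ i, μ {i} = 1 := by
      rw [sum_measure_singleton, Finset.coe_univ, measure_univ]
    simp only [hμ] at h
    rw [← ENNReal.ofReal_sum_of_nonneg fun i _ => hρ0 i, ENNReal.ofReal_eq_one] at h
    exact h
  have hS0 : 0 < S := by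
    refine lt_of_le_of_ne (by positivity) fun h => ?_
    simp [hρ, ← h] at hρ1
  have hSm : S ≤ m * B := by
    simpa using sum_sum_norm_sq_le fun x => (hframe x).2
  have hm0 : (0 : ℝ) < m := by
    by_contra h
    nlinarith [not_lt.1 h]
  have hm1 : (1 : ℝ) ≤ m := by exact_mod_cast Nat.one_le_iff_ne_zero.2 (by rintro rfl; simp at hm0)
  set L := Real.log (2 * m / p)
  have hL0 : 0 < L := Real.log_pos (by rw [lt_div_iff₀ hp]; linarith)
  have hn0 : (0 : ℝ) < n := lt_of_lt_of_le (by positivity) hn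
  have hnS : 3 * S * L ≤ n * A * t ^ 2 := by
    have h : 3 * B / (A * t ^ 2) * m * L = 3 * (m * B) * L / (A * t ^ 2) := by ring
    rw [h, div_le_iff₀ (by positivity)] at hn
    calc 3 * S * L ≤ 3 * (m * B) * L := by gcongr
      _ ≤ n * (A * t ^ 2) := hn
      _ = n * A * t ^ 2 := by ring
  set u : Fin M → Fin m → ℂ := fun i => unitVec (y i)
  have hρu (i : Fin M) (x : Fin m → ℂ) :
      ρ i * ‖star (u i) ⬝ᵥ x‖ ^ 2 = S⁻¹ * ‖star (y i) ⬝ᵥ x‖ ^ 2 := by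
    rw [hρ, ← sum_norm_sq_mul_norm_star_unitVec_dotProduct_sq (y i) x]
    ring
  have hρy (i : Fin M) (x : Fin m → ℂ) :
      (ρ i)⁻¹ * ‖star (y i) ⬝ᵥ x‖ ^ 2 = S * ‖star (u i) ⬝ᵥ x‖ ^ 2 := by
    rw [hρ, norm_star_unitVec_dotProduct_sq, inv_div]
    ring
  have hu1 (i : Fin M) : ∑ j, ‖u i j‖ ^ 2 ≤ 1 := sum_norm_unitVec_sq_le (y i)
  have hc : 0 < Real.log (1 + t) := Real.log_pos (by linarith)
  have hec : Real.exp (Real.log (1 + t)) = 1 + t := Real.exp_log (by linarith)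
  have hupper := sum_prod_tail_le hρ0 hρ1 hu1 (c := Real.log (1 + t)) (β := B / S)
    (fun x => by
      simp only [hρu, ← Finset.mul_sum, hec]
      have h := mul_le_mul_of_nonneg_left (hframe x).2 (by positivity : 0 ≤ t * S⁻¹)
      calc _ = t * S⁻¹ * ∑ i, ‖star (y i) ⬝ᵥ x‖ ^ 2 := by ring
        _ ≤ _ := h
        _ = _ := by ring)
    n (Real.log (1 + t) * ((1 + t) * (n * B / S)))
  have hlower := sum_prod_tail_le hρ0 hρ1 hu1 (c := -t) (β := A / S)
    (fun x => by
      simp only [hρu, ← Finset.mul_sum]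
      have ht2 : 0 ≤ 1 - Real.exp (-t) := by
        rw [sub_nonneg, Real.exp_le_one_iff]
        linarith
      have h := mul_le_mul_of_nonneg_left (hframe x).1
        (by positivity : 0 ≤ (1 - Real.exp (-t)) * S⁻¹)
      calc _ = -((1 - Real.exp (-t)) * S⁻¹ * ∑ i, ‖star (y i) ⬝ᵥ x‖ ^ 2) := by ring
        _ ≤ _ := neg_le_neg h
        _ = _ := by ring)
    n (-t * ((1 - t) * (n * A / S)))
  rw [Fintype.card_fin] at hupper hlower
  have hupper' := hupper.trans (mul_exp_le_half hm0 hp (by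
    rw [hec]
    have h := mul_le_mul_of_nonneg_left (sub_mul_log_one_add_le ht ht1)
      (by positivity : 0 ≤ n * B / S)
    have h2 : L ≤ n * B / S * (t ^ 2 / 3) := by
      rw [div_mul_eq_mul_div, le_div_iff₀ hS0]
      have : n * A * t ^ 2 ≤ n * B * t ^ 2 := by gcongr
      linarith
    calc _ = n * B / S * (t - Real.log (1 + t) * (1 + t)) := by ring
      _ ≤ _ := h
      _ ≤ _ := by linarith))
  have hlower' := hlower.trans_lt (mul_exp_lt_half hm0 hp (by
    have h := mul_le_mul_of_nonneg_left (exp_neg_sub_one_add_le ht.le)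
      (by positivity : 0 ≤ n * A / S)
    have h2 : L < n * A / S * (t ^ 2 / 2) := by
      rw [div_mul_eq_mul_div, lt_div_iff₀ hS0]
      nlinarith [mul_pos hL0 hS0]
    calc _ = n * A / S * (Real.exp (-t) - 1 + t * (1 - t)) := by ring
      _ ≤ _ := h
      _ < _ := by linarith))
  rw [← pi_real_finset hρ0 hμ] at hupper' hlower'
  set G := {j : Fin n → Fin M | ∀ a : Fin m → ℂ,
          (1 - t) * A * ∑ jj, ‖a jj‖ ^ 2 ≤
            (1 / n) * ∑ k, (ρ (j k))⁻¹ * ‖star (y (j k)) ⬝ᵥ a‖ ^ 2 ∧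
          (1 / n) * ∑ k, (ρ (j k))⁻¹ * ‖star (y (j k)) ⬝ᵥ a‖ ^ 2 ≤
            (1 + t) * B * ∑ jj, ‖a jj‖ ^ 2} with hG
  have hcompl := measureReal_compl (μ := Measure.pi fun _ : Fin n => μ) (s := G)
    G.toFinite.measurableSet
  rw [probReal_univ] at hcompl
  rw [ENNReal.ofReal_lt_iff_lt_toReal (by linarith) (measure_ne_top _ _), ← measureReal_def]
  suffices h : (Measure.pi fun _ : Fin n => μ).real Gᶜ < p by linarith
  refine lt_of_le_of_lt (measureReal_mono ?_) ((measureReal_union_le _ _).trans_lt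
    ((add_lt_add_of_le_of_lt hupper' hlower').trans_eq (add_halves p)))
  intro j hj
  simp only [hG, hρy, ← Finset.mul_sum, Set.mem_compl_iff, Set.mem_ofPred_eq, not_forall,
    not_and_or, not_le] at hj
  obtain ⟨a, ha | ha⟩ := hj
  · refine Or.inr (by
      rw [Finset.mem_coe, Finset.mem_filter]
      refine ⟨Finset.mem_univ j, a, ?_⟩
      have h := mul_lt_mul_of_pos_left ha (by positivity : 0 < t * (n / S))
      have h1 : t * (n / S) * (1 / n * (S * ∑ k, ‖star (u (j k)) ⬝ᵥ a‖ ^ 2)) =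
          t * ∑ k, ‖star (u (j k)) ⬝ᵥ a‖ ^ 2 := by field_simp
      rw [h1] at h
      calc _ = -(t * (n / S) * ((1 - t) * A * ∑ l, ‖a l‖ ^ 2)) := by ring
        _ < _ := neg_lt_neg h
        _ = _ := by ring)
  · refine Or.inl (by
      rw [Finset.mem_coe, Finset.mem_filter]
      refine ⟨Finset.mem_univ j, a, ?_⟩
      have h := mul_lt_mul_of_pos_left ha (by positivity : 0 < Real.log (1 + t) * (n / S))
      have h1 : Real.log (1 + t) * (n / S) *
          (1 / n * (S * ∑ k, ‖star (u (j k)) ⬝ᵥ a‖ ^ 2)) =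
          Real.log (1 + t) * ∑ k, ‖star (u (j k)) ⬝ᵥ a‖ ^ 2 := by field_simp
      rw [h1] at h
      calc _ = Real.log (1 + t) * (n / S) * ((1 + t) * B * ∑ l, ‖a l‖ ^ 2) := by ring
        _ < _ := h)
end

section
/- Let $(y^i)_{i=1}^M \subset \mathbb{C}^m$ be a frame with bounds $0 < A \le B < \infty$, let $\kappa := (\frac{B}{2A} + \frac{1}{2}) + \sqrt{(\frac{B}{2A} + \frac{1}{2})^2 - 1}$, and let $b > \kappa^2$. Then there exist a subset $J \subseteq \{1,\dots,M\}$ with $|J| \le \lceil bm \rceil$ and nonnegative weights $s_i \ge 0$ for $i \in J$ such that for all $a \in \mathbb{C}^m$: $A \|a\|_2^2 \le \sum_{i \in J} s_i |\langle a, y^i \rangle|^2 \le \gamma B \|a\|_2^2$, where $\gamma := \frac{(\sqrt{b}+1)^2}{(\sqrt{b}-1)(\sqrt{b}-\kappa)}$. -/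
open Matrix

section RankOneUpdate

open scoped ComplexOrder

variable {n : Type*} [Fintype n] [DecidableEq n]

/-- The Sherman–Morrison formula for a positive definite matrix, together with the criterion for
the update to stay positive definite. -/
theorem Matrix.PosDef.add_smul_vecMulVec {Q : Matrix n n ℂ} (hQ : Q.PosDef) (v : n → ℂ)
    {t p q : ℝ} (hp : star v ⬝ᵥ Q⁻¹ *ᵥ v = p) (hq : star v ⬝ᵥ (Q⁻¹ * Q⁻¹) *ᵥ v = q)
    (ht : 0 < 1 + t * p) :
    (Q + t • vecMulVec v (star v)).PosDef ∧
      ((Q + t • vecMulVec v (star v))⁻¹.trace).re = (Q⁻¹.trace).re - t * q / (1 + t * p) := by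
  set z := Q⁻¹ *ᵥ v with hz
  have hinv : Q * Q⁻¹ = 1 := mul_nonsing_inv Q ((isUnit_iff_isUnit_det Q).1 hQ.isUnit)
  have hQz : Q *ᵥ z = v := by rw [hz, mulVec_mulVec, hinv, one_mulVec]
  have hsz : star v ᵥ* Q⁻¹ = star z := by
    rw [hz, star_mulVec, hQ.inv.isHermitian.eq]
  have hzz : z ⬝ᵥ star z = q := by
    rw [← hq, ← mulVec_mulVec, dotProduct_mulVec, hsz, dotProduct_comm]
  set c : ℝ := t / (1 + t * p) with hc
  have hcoef : t - c - t * c * p = 0 := by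
    rw [hc]; field_simp; ring
  have hR : (Q + t • vecMulVec v (star v)) * (Q⁻¹ - c • vecMulVec z (star z)) = 1 := by
    have h1 : (Q + t • vecMulVec v (star v)) * (Q⁻¹ - c • vecMulVec z (star z))
        = 1 + (t - c - t * c * p) • vecMulVec v (star z) := by
      rw [add_mul, mul_sub, mul_sub, hinv, smul_mul_assoc, smul_mul_assoc, vecMulVec_mul, hsz,
        mul_smul_comm, mul_smul_comm, mul_vecMulVec, hQz, vecMulVec_mul_vecMulVec, hp]
      ext i j
      simp [vecMulVec_apply]
      ring
    rw [h1, hcoef, zero_smul, add_zero]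
  have hinv' := inv_eq_right_inv hR
  constructor
  · rcases le_total 0 t with h | h
    · exact hQ.add_posSemidef ((posSemidef_vecMulVec_self_star v).smul h)
    · rw [← posDef_inv_iff, hinv', sub_eq_add_neg, ← neg_smul]
      refine hQ.inv.add_posSemidef ((posSemidef_vecMulVec_self_star z).smul ?_)
      exact neg_nonneg.2 (div_nonpos_of_nonpos_of_nonneg h ht.le)
  · rw [hinv', trace_sub, trace_smul, trace_vecMulVec, hzz, Complex.sub_re, Complex.smul_re,
      Complex.ofReal_re, smul_eq_mul, hc]
    ring

end RankOneUpdate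

section UnitaryDiagonal

open scoped ComplexOrder

variable {n : Type*} [Fintype n] [DecidableEq n]

/-- The Hermitian matrix with eigenvalues `f` in the orthonormal basis of columns of `U`. -/
noncomputable def unitaryDiagonal (U : unitaryGroup n ℂ) (f : n → ℝ) : Matrix n n ℂ :=
  U * diagonal (fun k => (f k : ℂ)) * star (U : Matrix n n ℂ)

variable (U : unitaryGroup n ℂ) (f g : n → ℝ)

theorem unitaryDiagonal_mul :
    unitaryDiagonal U f * unitaryDiagonal U g = unitaryDiagonal U (f * g) := by
  have hU : star (U : Matrix n n ℂ) * U = 1 := Unitary.coe_star_mul_self U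
  calc _ = (U : Matrix n n ℂ) * diagonal (fun k => (f k : ℂ)) * (star (U : Matrix n n ℂ) * U) *
        diagonal (fun k => (g k : ℂ)) * star (U : Matrix n n ℂ) := by
        simp only [unitaryDiagonal, Matrix.mul_assoc]
    _ = _ := by
        rw [hU, Matrix.mul_one, Matrix.mul_assoc (U : Matrix n n ℂ), diagonal_mul_diagonal]
        simp [unitaryDiagonal]

theorem unitaryDiagonal_const (c : ℝ) : unitaryDiagonal U (fun _ => c) = c • 1 := by
  have h : diagonal (fun _ : n => (c : ℂ)) = c • (1 : Matrix n n ℂ) := by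
    ext i j; simp [diagonal_apply, one_apply]
  rw [unitaryDiagonal, h, mul_smul_comm, Matrix.mul_one, smul_mul_assoc]
  exact congrArg (c • ·) (Unitary.coe_mul_star_self U)

theorem unitaryDiagonal_sub :
    unitaryDiagonal U f - unitaryDiagonal U g = unitaryDiagonal U (f - g) := by
  rw [unitaryDiagonal, unitaryDiagonal, unitaryDiagonal, ← Matrix.sub_mul, ← Matrix.mul_sub,
    diagonal_sub]
  simp

theorem posDef_unitaryDiagonal_iff : (unitaryDiagonal U f).PosDef ↔ ∀ k, 0 < f k := by
  rw [unitaryDiagonal, Unitary.isUnit_coe.posDef_star_right_conjugate_iff,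
    posDef_diagonal_iff]
  simp

theorem trace_unitaryDiagonal : (unitaryDiagonal U f).trace = ((∑ k, f k : ℝ) : ℂ) := by
  rw [unitaryDiagonal, trace_mul_comm, ← Matrix.mul_assoc, Unitary.coe_star_mul_self,
    Matrix.one_mul, trace_diagonal]
  simp

theorem inv_unitaryDiagonal (hf : ∀ k, f k ≠ 0) :
    (unitaryDiagonal U f)⁻¹ = unitaryDiagonal U (fun k => (f k)⁻¹) := by
  apply inv_eq_right_inv
  rw [unitaryDiagonal_mul]
  have : f * (fun k => (f k)⁻¹) = fun _ => 1 := by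
    ext k; simp [hf k]
  rw [this, unitaryDiagonal_const, one_smul]

theorem star_dotProduct_unitaryDiagonal_mulVec (v : n → ℂ) :
    star v ⬝ᵥ unitaryDiagonal U f *ᵥ v =
      ((∑ k, f k * ‖star v ⬝ᵥ (U : Matrix n n ℂ).col k‖ ^ 2 : ℝ) : ℂ) := by
  rw [unitaryDiagonal, ← mulVec_mulVec, ← mulVec_mulVec, dotProduct_mulVec, dotProduct]
  push_cast
  refine Finset.sum_congr rfl fun k _ => ?_
  have h : (star (U : Matrix n n ℂ) *ᵥ v) k = star (star v ⬝ᵥ (U : Matrix n n ℂ).col k) := by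
    simp [mulVec, dotProduct, star_apply, mul_comm]
  have h' : (star v ᵥ* (U : Matrix n n ℂ)) k = star v ⬝ᵥ (U : Matrix n n ℂ).col k := rfl
  rw [mulVec_diagonal, h, h', ← Complex.mul_conj']
  simp only [starRingEnd_apply]
  ring

theorem sum_norm_sq_col_unitaryGroup (k : n) : ∑ j, ‖(U : Matrix n n ℂ).col k j‖ ^ 2 = 1 := by
  have h := congrFun (congrFun (Unitary.coe_star_mul_self U) k) k
  simp only [mul_apply, star_apply, one_apply_eq] at h
  have h2 : ((∑ j, ‖(U : Matrix n n ℂ).col k j‖ ^ 2 : ℝ) : ℂ) = 1 := by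
    rw [← h]
    push_cast
    refine Finset.sum_congr rfl fun j _ => ?_
    rw [← Complex.conj_mul']
    simp [col]
  exact_mod_cast h2

theorem Matrix.IsHermitian.exists_eq_unitaryDiagonal {X : Matrix n n ℂ} (hX : X.IsHermitian) :
    ∃ (U : unitaryGroup n ℂ) (f : n → ℝ), X = unitaryDiagonal U f :=
  ⟨hX.eigenvectorUnitary, hX.eigenvalues, by
    conv_lhs => rw [hX.spectral_theorem, Unitary.conjStarAlgAut_apply]
    rfl⟩

end UnitaryDiagonal

section BarrierShift

variable {n : Type*} [Fintype n]

/-- Cost of moving the upper barrier by `δ`. -/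
theorem upper_barrier_sum_le {p w : n → ℝ} {B δ ε : ℝ} (hp : ∀ k, 0 < p k)
    (hw : ∀ k, w k ≤ B) (hB : 0 < B) (hδ : 0 < δ) (hε : ∑ k, (p k)⁻¹ ≤ ε) :
    ∑ k, (p k + δ)⁻¹ * (p k + δ)⁻¹ * w k +
        (∑ k, (p k)⁻¹ - ∑ k, (p k + δ)⁻¹) * ∑ k, (p k + δ)⁻¹ * w k ≤
      (∑ k, (p k)⁻¹ - ∑ k, (p k + δ)⁻¹) * (B * (1 / δ + ε)) := by
  have hpos : ∀ k, 0 < p k + δ := fun k => add_pos (hp k) hδ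
  have hanti : ∀ k, (p k + δ)⁻¹ ≤ (p k)⁻¹ := fun k =>
    inv_anti₀ (hp k) (le_add_of_nonneg_right hδ.le)
  have hsum : ∑ k, (p k + δ)⁻¹ ≤ ∑ k, (p k)⁻¹ := Finset.sum_le_sum fun k _ => hanti k
  have h1 : ∑ k, (p k + δ)⁻¹ * (p k + δ)⁻¹ * w k ≤
      (∑ k, (p k)⁻¹ - ∑ k, (p k + δ)⁻¹) * (B * (1 / δ)) := by
    rw [← Finset.sum_sub_distrib, Finset.sum_mul]
    refine Finset.sum_le_sum fun k _ => ?_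
    have hq := inv_pos.2 (hpos k)
    have e : ((p k)⁻¹ - (p k + δ)⁻¹) * (B * (1 / δ)) = (p k)⁻¹ * (p k + δ)⁻¹ * B := by
      have := (hp k).ne'
      have := (hpos k).ne'
      field_simp
      ring
    rw [e]
    calc _ ≤ (p k + δ)⁻¹ * (p k + δ)⁻¹ * B := by gcongr; exact hw k
      _ ≤ _ := by
          have := hanti k
          gcongr
  have h2 : ∑ k, (p k + δ)⁻¹ * w k ≤ B * ε := by
    calc _ ≤ ∑ k, (p k + δ)⁻¹ * B := by
          refine Finset.sum_le_sum fun k _ => ?_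
          have hq := inv_pos.2 (hpos k)
          gcongr
          exact hw k
      _ = B * ∑ k, (p k + δ)⁻¹ := by rw [← Finset.sum_mul, mul_comm]
      _ ≤ _ := by gcongr; exact hsum.trans hε
  have h3 := mul_le_mul_of_nonneg_left h2 (sub_nonneg.2 hsum)
  linarith

/-- Gain from moving the lower barrier by `δ`; here `q k` are the distances to the new barrier. -/
theorem le_lower_barrier_sum {q w : n → ℝ} {A B δ ε : ℝ} (hq : ∀ k, 0 < q k)
    (hAw : ∀ k, A ≤ w k) (hwB : ∀ k, w k ≤ B) (hδ : 0 < δ)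
    (hε : ∑ k, (q k + δ)⁻¹ ≤ ε) (hδε : B * (δ * ε) ≤ A) (hB : 0 < B) :
    (∑ k, (q k)⁻¹ - ∑ k, (q k + δ)⁻¹) * (A / δ - B * ε) ≤
      ∑ k, (q k)⁻¹ * (q k)⁻¹ * w k -
        (∑ k, (q k)⁻¹ - ∑ k, (q k + δ)⁻¹) * ∑ k, (q k)⁻¹ * w k := by
  have hpos : ∀ k, 0 < q k + δ := fun k => add_pos (hq k) hδ
  set D := ∑ k, (q k)⁻¹ - ∑ k, (q k + δ)⁻¹ with hD
  have hDeq : D = δ * ∑ k, (q k + δ)⁻¹ * (q k)⁻¹ := by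
    rw [hD, ← Finset.sum_sub_distrib, Finset.mul_sum]
    refine Finset.sum_congr rfl fun k _ => ?_
    have := (hq k).ne'
    have := (hpos k).ne'
    field_simp
    ring
  have hD0 : 0 ≤ D := by
    rw [hDeq]
    exact mul_nonneg hδ.le (Finset.sum_nonneg fun k _ =>
      mul_nonneg (inv_pos.2 (hpos k)).le (inv_pos.2 (hq k)).le)
  set T := ∑ k, (q k + δ)⁻¹ * ((q k)⁻¹) ^ 2 with hT
  have hT0 : 0 ≤ T := Finset.sum_nonneg fun k _ =>
      mul_nonneg (inv_pos.2 (hpos k)).le (sq_nonneg _)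
  have hcs : (∑ k, (q k + δ)⁻¹ * (q k)⁻¹) ^ 2 ≤ ε * T := by
    calc _ ≤ (∑ k, (q k + δ)⁻¹) * T := by
          refine Finset.sum_sq_le_sum_mul_sum_of_sq_le_mul _ (fun k _ => (inv_pos.2 (hpos k)).le)
            (fun k _ => mul_nonneg (inv_pos.2 (hpos k)).le (sq_nonneg _)) 
            fun k _ => (by ring : _ = _).le
      _ ≤ _ := by gcongr
  have hsq : ∑ k, (q k)⁻¹ * (q k)⁻¹ = D / δ + δ * T := by
    rw [hDeq, hT, mul_div_cancel_left₀ _ hδ.ne', Finset.mul_sum, ← Finset.sum_add_distrib]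
    refine Finset.sum_congr rfl fun k _ => ?_
    have := (hq k).ne'
    have := (hpos k).ne'
    field_simp
  have h1 : A * (D / δ + δ * T) ≤ ∑ k, (q k)⁻¹ * (q k)⁻¹ * w k := by
    rw [← hsq, Finset.mul_sum]
    refine Finset.sum_le_sum fun k _ => ?_
    rw [mul_comm]
    have := inv_pos.2 (hq k)
    gcongr
    exact hAw k
  have h2 : ∑ k, (q k)⁻¹ * w k ≤ B * (D + ε) := by
    calc _ ≤ ∑ k, (q k)⁻¹ * B := by
          refine Finset.sum_le_sum fun k _ => ?_
          have := inv_pos.2 (hq k)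
          gcongr
          exact hwB k
      _ = B * ∑ k, (q k)⁻¹ := by rw [← Finset.sum_mul, mul_comm]
      _ ≤ _ := by gcongr; rw [hD]; linarith
  have h3 := mul_le_mul_of_nonneg_left h2 hD0
  have h4 : B * D ^ 2 ≤ A * (δ * T) := by
    rw [hDeq]
    calc _ = B * δ ^ 2 * (∑ k, (q k + δ)⁻¹ * (q k)⁻¹) ^ 2 := by ring
      _ ≤ B * δ ^ 2 * (ε * T) := by gcongr
      _ = B * (δ * ε) * (δ * T) := by ring
      _ ≤ _ := by gcongr
  have h5 : D * (A / δ - B * ε) = A * (D / δ) - B * D * ε := by ring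
  rw [h5]
  nlinarith

end BarrierShift

section BarrierStep

open scoped ComplexOrder

variable {n ι : Type*} [Fintype n] [DecidableEq n] [Fintype ι]

/-- The spectrum of `X` lies strictly between the barriers `l` and `u`, with lower and upper
barrier potentials at most `εL` and `εU`. -/
structure IsBetweenBarriers (X : Matrix n n ℂ) (l u εL εU : ℝ) : Prop where
  posDef_lower : (X - l • 1).PosDef
  posDef_upper : (u • 1 - X).PosDef
  potential_lower : ((X - l • 1)⁻¹.trace).re ≤ εL
  potential_upper : ((u • 1 - X)⁻¹.trace).re ≤ εU

theorem isBetweenBarriers_zero [Nonempty n] {εL εU : ℝ} (hεL : 0 < εL) (hεU : 0 < εU) :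
    IsBetweenBarriers (0 : Matrix n n ℂ) (-(Fintype.card n / εL)) (Fintype.card n / εU) εL εU := by
  have hn : (0 : ℝ) < Fintype.card n := by exact_mod_cast Fintype.card_pos
  have key : ∀ ε : ℝ, 0 < ε → ((Fintype.card n / ε) • (1 : Matrix n n ℂ)).PosDef ∧
      (((Fintype.card n / ε) • (1 : Matrix n n ℂ))⁻¹.trace).re ≤ ε := by
    intro ε hε
    have hc : 0 < Fintype.card n / ε := div_pos hn hε
    rw [← unitaryDiagonal_const 1, posDef_unitaryDiagonal_iff,
      inv_unitaryDiagonal _ _ fun _ => hc.ne', trace_unitaryDiagonal, Complex.ofReal_re]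
    refine ⟨fun _ => hc, le_of_eq ?_⟩
    rw [Finset.sum_const, Finset.card_univ, nsmul_eq_mul]
    field_simp
  obtain ⟨hl, hl'⟩ := key εL hεL
  obtain ⟨hu, hu'⟩ := key εU hεU
  constructor <;> simpa

/-- Both barriers can be moved, keeping the potentials bounded, after adding a positive multiple
of a suitable frame vector. -/
theorem IsBetweenBarriers.exists_step [Nonempty n] {y : ι → n → ℂ} {A B : ℝ} (hA : 0 < A)
    (hB : 0 < B)
    (hframe : ∀ x : n → ℂ,
      A * ∑ j, ‖x j‖ ^ 2 ≤ ∑ i, ‖star (y i) ⬝ᵥ x‖ ^ 2 ∧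
      ∑ i, ‖star (y i) ⬝ᵥ x‖ ^ 2 ≤ B * ∑ j, ‖x j‖ ^ 2)
    {X : Matrix n n ℂ} {l u εL εU : ℝ} (hX : IsBetweenBarriers X l u εL εU)
    {η δ : ℝ} (hη : 0 < η) (hδ : 0 < δ) (hηε : B * (η * εL) ≤ A) (hη1 : η * εL < 1)
    (hbal : B * (1 / δ + εU) ≤ A / η - B * εL) :
    ∃ (i : ι) (t : ℝ), 0 < t ∧
      IsBetweenBarriers (X + t • vecMulVec (y i) (star (y i))) (l + η) (u + δ) εL εU := by
  obtain ⟨hl, hu, hΦl, hΦu⟩ := hX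
  have hXh : X.IsHermitian := by
    have h : (l • (1 : Matrix n n ℂ)).IsHermitian := by
      simp [IsHermitian, conjTranspose_smul]
    simpa using hl.isHermitian.add h
  obtain ⟨U, f, rfl⟩ := hXh.exists_eq_unitaryDiagonal
  have hlow : ∀ c : ℝ, unitaryDiagonal U f - c • 1 = unitaryDiagonal U (fun k => f k - c) :=
    fun c => by rw [← unitaryDiagonal_const U c, unitaryDiagonal_sub]; rfl
  have hup : ∀ c : ℝ, c • 1 - unitaryDiagonal U f = unitaryDiagonal U (fun k => c - f k) :=
    fun c => by rw [← unitaryDiagonal_const U c, unitaryDiagonal_sub]; rfl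
  rw [hlow, posDef_unitaryDiagonal_iff] at hl
  rw [hup, posDef_unitaryDiagonal_iff] at hu
  rw [hlow, inv_unitaryDiagonal _ _ fun k => (hl k).ne', trace_unitaryDiagonal,
    Complex.ofReal_re] at hΦl
  rw [hup, inv_unitaryDiagonal _ _ fun k => (hu k).ne', trace_unitaryDiagonal,
    Complex.ofReal_re] at hΦu
  have hq : ∀ k, 0 < f k - (l + η) := by
    intro k
    have h1 : (f k - l)⁻¹ ≤ εL :=
      (Finset.single_le_sum (f := fun k => (f k - l)⁻¹) (fun j _ => (inv_pos.2 (hl j)).le)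
        (Finset.mem_univ k)).trans hΦl
    have h2 : η * (f k - l)⁻¹ < 1 := (mul_le_mul_of_nonneg_left h1 hη.le).trans_lt hη1
    rw [← div_eq_mul_inv, div_lt_one (hl k)] at h2
    linarith
  have hp : ∀ k, 0 < u + δ - f k := fun k => by linarith [hu k]
  set p : n → ℝ := fun k => u + δ - f k with hpdef
  set q : n → ℝ := fun k => f k - (l + η) with hqdef
  set w : ι → n → ℝ := fun i k => ‖star (y i) ⬝ᵥ (U : Matrix n n ℂ).col k‖ ^ 2 with hw
  have hwsum : ∀ k, A ≤ ∑ i, w i k ∧ ∑ i, w i k ≤ B := by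
    intro k
    simpa only [sum_norm_sq_col_unitaryGroup, mul_one] using hframe ((U : Matrix n n ℂ).col k)
  have hswap : ∀ g : n → ℝ, ∑ k, g k * ∑ i, w i k = ∑ i, ∑ k, g k * w i k := by
    intro g
    simp_rw [Finset.mul_sum]
    exact Finset.sum_comm
  have hU := upper_barrier_sum_le (p := fun k => u - f k) (w := fun k => ∑ i, w i k) hu
    (fun k => (hwsum k).2) hB hδ hΦu
  have hL := le_lower_barrier_sum (q := q) (w := fun k => ∑ i, w i k) (ε := εL) hq
    (fun k => (hwsum k).1) (fun k => (hwsum k).2) hη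
    (by simpa [hqdef, sub_add_eq_sub_sub] using hΦl) hηε hB
  have hpe : ∀ k, u - f k + δ = p k := fun k => by simp only [hpdef]; ring
  have hqe : ∀ k, q k + η = f k - l := fun k => by simp only [hqdef]; ring
  simp only [hpe] at hU
  simp only [hqe] at hL
  set DU := ∑ k, (u - f k)⁻¹ - ∑ k, (p k)⁻¹ with hDU
  set DL := ∑ k, (q k)⁻¹ - ∑ k, (f k - l)⁻¹ with hDL
  have hDU0 : 0 < DU := sub_pos.2 <| Finset.sum_lt_sum_of_nonempty Finset.univ_nonempty
    fun k _ => inv_strictAnti₀ (hu k) (by simp only [hpdef]; linarith)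
  have hDL0 : 0 < DL := sub_pos.2 <| Finset.sum_lt_sum_of_nonempty Finset.univ_nonempty
    fun k _ => inv_strictAnti₀ (hq k) (by simp only [hqdef]; linarith)
  simp only [hswap] at hU hL
  set P₁ : ι → ℝ := fun i => ∑ k, (p k)⁻¹ * w i k with hP₁
  set P₂ : ι → ℝ := fun i => ∑ k, (p k)⁻¹ * (p k)⁻¹ * w i k with hP₂
  set Q₁ : ι → ℝ := fun i => ∑ k, (q k)⁻¹ * w i k with hQ₁
  set Q₂ : ι → ℝ := fun i => ∑ k, (q k)⁻¹ * (q k)⁻¹ * w i k with hQ₂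
  have hsum : ∑ i, (P₂ i / DU + P₁ i) ≤ ∑ i, (Q₂ i / DL - Q₁ i) := by
    rw [Finset.sum_add_distrib, Finset.sum_sub_distrib, ← Finset.sum_div, ← Finset.sum_div]
    have h1 : (∑ i, P₂ i) / DU + ∑ i, P₁ i ≤ B * (1 / δ + εU) := by
      rw [div_add' _ _ _ hDU0.ne', div_le_iff₀ hDU0]
      linarith
    have h2 : A / η - B * εL ≤ (∑ i, Q₂ i) / DL - ∑ i, Q₁ i := by
      rw [div_sub' hDL0.ne', le_div_iff₀ hDL0]
      linarith
    exact h1.trans (hbal.trans h2)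
  obtain ⟨i, hyi, hi⟩ : ∃ i, y i ≠ 0 ∧ P₂ i / DU + P₁ i ≤ Q₂ i / DL - Q₁ i := by
    by_contra! hcon
    obtain ⟨i₀, hi₀⟩ : ∃ i, y i ≠ 0 := by
      by_contra! h0
      have := (hwsum (Classical.arbitrary n)).1
      simp [hw, h0] at this
      linarith
    refine absurd hsum (not_le.2 (Finset.sum_lt_sum (fun i _ => ?_)
      ⟨i₀, Finset.mem_univ _, hcon i₀ hi₀⟩))
    by_cases h0 : y i = 0
    · simp [hP₁, hP₂, hQ₁, hQ₂, hw, h0]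
    · exact (hcon i h0).le
  have hform : ∀ g : n → ℝ, star (y i) ⬝ᵥ unitaryDiagonal U g *ᵥ y i =
      ((∑ k, g k * w i k : ℝ) : ℂ) := fun g => star_dotProduct_unitaryDiagonal_mulVec U g (y i)
  have hP₂pos : 0 < P₂ i := by
    have h := ((posDef_unitaryDiagonal_iff U fun k => (p k)⁻¹ * (p k)⁻¹).2 fun k =>
      mul_pos (inv_pos.2 (hp k)) (inv_pos.2 (hp k))).dotProduct_mulVec_pos hyi
    rw [hform] at h
    exact_mod_cast h
  have hw0 : ∀ k, 0 ≤ w i k := fun k => sq_nonneg _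
  have hP₁0 : 0 ≤ P₁ i := Finset.sum_nonneg fun k _ => mul_nonneg (inv_pos.2 (hp k)).le (hw0 k)
  have hQ₁0 : 0 ≤ Q₁ i := Finset.sum_nonneg fun k _ => mul_nonneg (inv_pos.2 (hq k)).le (hw0 k)
  have hPD : 0 < P₂ i / DU := div_pos hP₂pos hDU0
  set r := P₂ i / DU + P₁ i with hr
  have hr0 : 0 < r := add_pos_of_pos_of_nonneg hPD hP₁0
  have hQinv := inv_unitaryDiagonal U q fun k => (hq k).ne'
  have hPinv := inv_unitaryDiagonal U p fun k => (hp k).ne'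
  obtain ⟨hlow₁, hlow₂⟩ := ((posDef_unitaryDiagonal_iff U q).2 hq).add_smul_vecMulVec (y i)
    (t := r⁻¹) (p := Q₁ i) (q := Q₂ i) (by rw [hQinv, hform])
    (by rw [hQinv, unitaryDiagonal_mul, hform]; rfl) (by positivity)
  obtain ⟨hup₁, hup₂⟩ := ((posDef_unitaryDiagonal_iff U p).2 hp).add_smul_vecMulVec (y i)
    (t := -r⁻¹) (p := P₁ i) (q := P₂ i) (by rw [hPinv, hform])
    (by rw [hPinv, unitaryDiagonal_mul, hform]; rfl) (by
      have : r⁻¹ * P₁ i < 1 := by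
        rw [inv_mul_lt_iff₀ hr0]; linarith
      linarith)
  have el : unitaryDiagonal U f + r⁻¹ • vecMulVec (y i) (star (y i)) - (l + η) • 1 =
      unitaryDiagonal U q + r⁻¹ • vecMulVec (y i) (star (y i)) := by
    rw [hqdef, ← hlow]; abel
  have eu : (u + δ) • 1 - (unitaryDiagonal U f + r⁻¹ • vecMulVec (y i) (star (y i))) =
      unitaryDiagonal U p + (-r⁻¹) • vecMulVec (y i) (star (y i)) := by
    rw [hpdef, ← hup, neg_smul]; abel
  refine ⟨i, r⁻¹, inv_pos.2 hr0, ?_⟩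
  constructor
  · rwa [el]
  · rwa [eu]
  · rw [el, hlow₂, hQinv, trace_unitaryDiagonal, Complex.ofReal_re]
    have h1 : r⁻¹ * Q₂ i / (1 + r⁻¹ * Q₁ i) = Q₂ i / (r + Q₁ i) := by
      field_simp
    have h2 : DL ≤ Q₂ i / (r + Q₁ i) := by
      rw [le_div_iff₀ (by positivity)]
      have h3 : r + Q₁ i ≤ Q₂ i / DL := by linarith
      rw [le_div_iff₀ hDL0] at h3
      linarith
    rw [h1]
    linarith
  · rw [eu, hup₂, hPinv, trace_unitaryDiagonal, Complex.ofReal_re]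
    have h1 : -r⁻¹ * P₂ i / (1 + -r⁻¹ * P₁ i) = -DU := by
      have h2 : 1 + -r⁻¹ * P₁ i = r⁻¹ * (P₂ i / DU) := by
        field_simp
        rw [hr]
        field_simp
        ring
      rw [h2]
      field_simp
    rw [h1]
    linarith

end BarrierStep

section Sparsification

open scoped ComplexOrder

variable {n ι : Type*} [Fintype n] [DecidableEq n]

theorem exists_sparse_isBetweenBarriers [Fintype ι] [Nonempty n] {y : ι → n → ℂ} {A B : ℝ} (hA : 0 < A)
    (hB : 0 < B)
    (hframe : ∀ x : n → ℂ,
      A * ∑ j, ‖x j‖ ^ 2 ≤ ∑ i, ‖star (y i) ⬝ᵥ x‖ ^ 2 ∧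
      ∑ i, ‖star (y i) ⬝ᵥ x‖ ^ 2 ≤ B * ∑ j, ‖x j‖ ^ 2)
    {η δ εL εU : ℝ} (hη : 0 < η) (hδ : 0 < δ) (hεL : 0 < εL) (hεU : 0 < εU)
    (hηε : B * (η * εL) ≤ A) (hη1 : η * εL < 1)
    (hbal : B * (1 / δ + εU) ≤ A / η - B * εL) (N : ℕ) :
    ∃ (J : Finset ι) (s : ι → ℝ), J.card ≤ N ∧ (∀ i, 0 ≤ s i) ∧
      IsBetweenBarriers (∑ i ∈ J, s i • vecMulVec (y i) (star (y i)))
        (-(Fintype.card n / εL) + N * η) (Fintype.card n / εU + N * δ) εL εU := by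
  classical
  suffices h : ∃ (J : Finset ι) (s : ι → ℝ), J.card ≤ N ∧ (∀ i, 0 ≤ s i) ∧ (∀ i ∉ J, s i = 0) ∧
      IsBetweenBarriers (∑ i, s i • vecMulVec (y i) (star (y i)))
        (-(Fintype.card n / εL) + N * η) (Fintype.card n / εU + N * δ) εL εU by
    obtain ⟨J, s, hJ, hs, hsJ, hX⟩ := h
    refine ⟨J, s, hJ, hs, ?_⟩
    rwa [Finset.sum_subset J.subset_univ fun i _ hi => by rw [hsJ i hi, zero_smul]]
  induction N with
  | zero => exact ⟨∅, 0, by simp, by simp, by simp, by simpa using isBetweenBarriers_zero hεL hεU⟩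
  | succ N ih =>
    obtain ⟨J, s, hJ, hs, hsJ, hX⟩ := ih
    obtain ⟨i, t, ht, hX'⟩ := hX.exists_step hA hB hframe hη hδ hηε hη1 hbal
    refine ⟨insert i J, s + Pi.single i t, ?_, ?_, ?_, ?_⟩
    · exact (Finset.card_insert_le i J).trans (Nat.succ_le_succ hJ)
    · intro j
      exact add_nonneg (hs j) ((Pi.single_nonneg.2 ht.le : (0 : ι → ℝ) ≤ Pi.single i t) j)
    · intro j hj
      rw [Finset.mem_insert, not_or] at hj
      simp [hsJ j hj.2, hj.1]
    · have h : ∑ j, (s + Pi.single i t : ι → ℝ) j • vecMulVec (y j) (star (y j)) =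
          ∑ j, s j • vecMulVec (y j) (star (y j)) + t • vecMulVec (y i) (star (y i)) := by
        simp only [Pi.add_apply, add_smul, Finset.sum_add_distrib]
        congr 1
        rw [Finset.sum_eq_single i] <;> simp +contextual
      rw [h]
      push_cast
      convert hX' using 1 <;> ring

theorem IsBetweenBarriers.sum_bounds {y : ι → n → ℂ} {J : Finset ι} {s : ι → ℝ}
    {l u εL εU : ℝ}
    (h : IsBetweenBarriers (∑ i ∈ J, s i • vecMulVec (y i) (star (y i))) l u εL εU)
    (a : n → ℂ) :
    l * ∑ j, ‖a j‖ ^ 2 ≤ ∑ i ∈ J, s i * ‖star (y i) ⬝ᵥ a‖ ^ 2 ∧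
      ∑ i ∈ J, s i * ‖star (y i) ⬝ᵥ a‖ ^ 2 ≤ u * ∑ j, ‖a j‖ ^ 2 := by
  have hone : ∀ c : ℝ, star a ⬝ᵥ (c • (1 : Matrix n n ℂ)) *ᵥ a =
      ((c * ∑ j, ‖a j‖ ^ 2 : ℝ) : ℂ) := by
    intro c
    rw [smul_mulVec, one_mulVec, dotProduct_smul, Complex.real_smul]
    push_cast
    congr 1
    exact Finset.sum_congr rfl fun j _ => by rw [← Complex.conj_mul']; rfl
  have hX : star a ⬝ᵥ (∑ i ∈ J, s i • vecMulVec (y i) (star (y i))) *ᵥ a =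
      ((∑ i ∈ J, s i * ‖star (y i) ⬝ᵥ a‖ ^ 2 : ℝ) : ℂ) := by
    rw [sum_mulVec, dotProduct_sum]
    push_cast
    refine Finset.sum_congr rfl fun i _ => ?_
    have hstar : star a ⬝ᵥ y i = star (star (y i) ⬝ᵥ a) := by
      rw [star_dotProduct]
    rw [smul_mulVec, dotProduct_smul, Complex.real_smul, vecMulVec_mulVec, dotProduct_smul,
      hstar, ← Complex.conj_mul']
    rfl
  have hl := h.posDef_lower.posSemidef.dotProduct_mulVec_nonneg a
  have hu := h.posDef_upper.posSemidef.dotProduct_mulVec_nonneg a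
  rw [sub_mulVec, dotProduct_sub, hone, hX, sub_nonneg, Complex.real_le_real] at hl hu
  exact ⟨hl, hu⟩

end Sparsification

theorem le_add_sqrt_half_add_half {r : ℝ} (hr : 1 ≤ r) :
    r ≤ (r / 2 + 1 / 2) + Real.sqrt ((r / 2 + 1 / 2) ^ 2 - 1) := by
  have h : (r - 1) / 2 ≤ Real.sqrt ((r / 2 + 1 / 2) ^ 2 - 1) :=
    Real.le_sqrt_of_sq_le (by nlinarith)
  linarith

/-- Deterministic weighted subsampling (BSS), Theorem 3.1 / Theorem `BSS`. -/
theorem stmt_1 (m M : ℕ) (y : Fin M → Fin m → ℂ) (A B : ℝ)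
    (hA : 0 < A) (hAB : A ≤ B)
    (hframe : ∀ x : Fin m → ℂ,
      A * ∑ j, ‖x j‖ ^ 2 ≤ ∑ i, ‖star (y i) ⬝ᵥ x‖ ^ 2 ∧
      ∑ i, ‖star (y i) ⬝ᵥ x‖ ^ 2 ≤ B * ∑ j, ‖x j‖ ^ 2)
    (κ b : ℝ)
    (hκ : κ = (B / (2 * A) + 1 / 2) + Real.sqrt ((B / (2 * A) + 1 / 2) ^ 2 - 1))
    (hb : κ ^ 2 < b) :
    ∃ (J : Finset (Fin M)) (s : Fin M → ℝ),
      J.card ≤ ⌈b * m⌉₊ ∧ (∀ i, 0 ≤ s i) ∧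
      ∀ a : Fin m → ℂ,
        A * ∑ j, ‖a j‖ ^ 2 ≤ ∑ i ∈ J, s i * ‖star (y i) ⬝ᵥ a‖ ^ 2 ∧
        ∑ i ∈ J, s i * ‖star (y i) ⬝ᵥ a‖ ^ 2 ≤
          (Real.sqrt b + 1) ^ 2 / ((Real.sqrt b - 1) * (Real.sqrt b - κ)) *
            (B * ∑ j, ‖a j‖ ^ 2) := by
  rcases Nat.eq_zero_or_pos m with rfl | hm
  · exact ⟨∅, 0, by simp, by simp, by simp⟩
  have : Nonempty (Fin m) := ⟨⟨0, hm⟩⟩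
  have hm' : (0 : ℝ) < m := by exact_mod_cast hm
  have hB : 0 < B := hA.trans_le hAB
  have hBA : 1 ≤ B / A := (one_le_div hA).2 hAB
  have hκBA : B / A ≤ κ := by
    have h := le_add_sqrt_half_add_half hBA
    rwa [div_div, mul_comm A 2, ← hκ] at h
  have hκ1 : 1 ≤ κ := hBA.trans hκBA
  have hβκ : κ < Real.sqrt b := (Real.lt_sqrt (by linarith)).2 hb
  have hbβ : b = Real.sqrt b ^ 2 := (Real.sq_sqrt ((sq_nonneg κ).trans hb.le)).symm
  set β := Real.sqrt b
  have hβ1 : 0 < β - 1 := by linarith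
  have hβκ' : 0 < β - κ := by linarith
  have hβ : 0 < β := by linarith
  have hκ0 : 0 < κ := by linarith
  have hBκ : B ≤ κ * A := (div_le_iff₀ hA).1 hκBA
  have hκβ : 1 < κ * β := by nlinarith
  set N := ⌈b * m⌉₊
  have hN : β ^ 2 * m ≤ N := hbβ ▸ Nat.le_ceil (b * m)
  obtain ⟨J, s, hJ, hs, hX⟩ := exists_sparse_isBetweenBarriers hA hB hframe (η := 1)
    (δ := B / A * ((β + 1) / (β - 1))) (εL := 1 / (κ * β))
    (εU := A / B * ((β - 1) / (β * (β + 1)))) one_pos (by positivity) (by positivity)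
    (by positivity)
    (by
      rw [one_mul, mul_one_div, div_le_iff₀ (by positivity)]
      nlinarith [mul_pos hκ0 hA])
    (by rwa [one_mul, div_lt_one (by positivity)])
    (by
      have h1 : B * (1 / (B / A * ((β + 1) / (β - 1))) + A / B * ((β - 1) / (β * (β + 1)))) =
          A - A / β := by
        field_simp
      have h2 : B * (1 / (κ * β)) ≤ A / β := by
        rw [mul_one_div, div_le_div_iff₀ (by positivity) hβ]
        nlinarith
      rw [h1, div_one]
      linarith) N
  have hbounds := hX.sum_bounds
  rw [Fintype.card_fin] at hbounds
  have hlN : (-(m / (1 / (κ * β))) + N * 1 : ℝ) = N - m * (κ * β) := by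
    rw [div_div_eq_mul_div, div_one]; ring
  have huN : (m / (A / B * ((β - 1) / (β * (β + 1)))) + N * (B / A * ((β + 1) / (β - 1))) : ℝ) =
      B / A * ((β + 1) / (β - 1) * (m * β + N)) := by
    field_simp
  rw [hlN, huN] at hbounds
  set l : ℝ := N - m * (κ * β) with hl
  have hl0 : 0 < l := by
    have : 0 < m * β * (β - κ) := by positivity
    nlinarith
  have hratio : A / l * (B / A * ((β + 1) / (β - 1) * (m * β + N))) ≤
      (β + 1) ^ 2 / ((β - 1) * (β - κ)) * B := by
    have h1 : A / l * (B / A * ((β + 1) / (β - 1) * (m * β + N))) =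
        (β + 1) * (m * β + N) / ((β - 1) * l) * B := by
      field_simp
    rw [h1]
    gcongr ?_ * B
    rw [div_le_div_iff₀ (by positivity) (by positivity)]
    have h2 : (m * β + N) * (β - κ) ≤ (β + 1) * l := by
      rw [hl]
      nlinarith [mul_le_mul_of_nonneg_left hN (by linarith : 0 ≤ 1 + κ)]
    nlinarith [mul_le_mul_of_nonneg_left h2 (by positivity : 0 ≤ (β + 1) * (β - 1))]
  refine ⟨J, fun i => A / l * s i, hJ, fun i => mul_nonneg (by positivity) (hs i), fun a => ?_⟩
  simp only [mul_assoc (A / l), ← Finset.mul_sum]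
  obtain ⟨h1, h2⟩ := hbounds a
  have hAl : 0 ≤ A / l := by positivity
  constructor
  · calc A * ∑ j, ‖a j‖ ^ 2 = A / l * (l * ∑ j, ‖a j‖ ^ 2) := by field_simp
      _ ≤ _ := mul_le_mul_of_nonneg_left h1 hAl
  · refine (mul_le_mul_of_nonneg_left h2 hAl).trans ?_
    rw [← mul_assoc (A / l), ← mul_assoc _ B]
    exact mul_le_mul_of_nonneg_right hratio (Finset.sum_nonneg fun j _ => sq_nonneg _)
end

section
/- Let $y^1, \dots, y^M$ be any vectors in $\mathbb{C}^m$ with $M \ge m$, and let $b > 1$. Then there exist nonnegative weights $s_1, \dots, s_M \ge 0$ with $|\{ i : s_i \ne 0 \}| \le \lceil bm \rceil$ such that for all $a \in \mathbb{C}^m$: $\sum_{i=1}^M |\langle a, y^i \rangle|^2 \le \sum_{i=1}^M s_i |\langle a, y^i \rangle|^2 \le \frac{(\sqrt{b}+1)^2}{(\sqrt{b}-1)^2} \sum_{i=1}^M |\langle a, y^i \rangle|^2$. -/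
open Matrix

open scoped ComplexOrder

/-- The eigenvalues of `B` compute the traces of the resolvents of `B` and of their squares. -/
lemma Matrix.PosDef.exists_trace_inv_add_smul_one {n : Type*} [Fintype n] [DecidableEq n]
    {B : Matrix n n ℂ} (hB : B.PosDef) :
    ∃ x : n → ℝ, (∀ j, 0 < x j) ∧ ∀ z : ℝ, (∀ j, 0 < x j + z) →
      (B + z • 1).PosDef ∧ (B + z • 1)⁻¹.trace.re = ∑ j, (x j + z)⁻¹ ∧
        ((B + z • 1)⁻¹ * (B + z • 1)⁻¹).trace.re = ∑ j, ((x j + z)⁻¹) ^ 2 := by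
  refine ⟨hB.1.eigenvalues, hB.eigenvalues_pos, fun z hz => ?_⟩
  set U : Matrix n n ℂ := hB.1.eigenvectorUnitary.1
  set x := hB.1.eigenvalues
  have hU : U * star U = 1 := Unitary.coe_mul_star_self _
  have hU' : star U * U = 1 := Unitary.coe_star_mul_self _
  have hUu : IsUnit U := IsUnit.of_mul_eq_one _ hU
  have hspec : B + z • 1 = U * diagonal (fun j => ((x j + z : ℝ) : ℂ)) * star U := by
    have h : B = U * diagonal (fun j => (x j : ℂ)) * star U := hB.1.spectral_theorem
    have hd : diagonal (fun j => ((x j + z : ℝ) : ℂ)) =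
        diagonal (fun j => (x j : ℂ)) + z • (1 : Matrix n n ℂ) := by
      ext i j
      by_cases hij : i = j <;> simp [hij, diagonal]
    rw [hd, mul_add, add_mul, ← h, mul_smul_comm, smul_mul_assoc, mul_one, hU]
  have hinv : (B + z • 1)⁻¹ = U * diagonal (fun j => (((x j + z)⁻¹ : ℝ) : ℂ)) * star U := by
    apply inv_eq_right_inv
    calc _ = U * (diagonal (fun j => ((x j + z : ℝ) : ℂ)) * (star U * U) *
          diagonal (fun j => (((x j + z)⁻¹ : ℝ) : ℂ))) * star U := by
            rw [hspec]; simp only [mul_assoc]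
      _ = 1 := by
        have hd : (fun j => ((x j + z : ℝ) : ℂ) * (((x j + z)⁻¹ : ℝ) : ℂ)) = fun _ => 1 := by
          ext j
          rw [← Complex.ofReal_mul, mul_inv_cancel₀ (hz j).ne', Complex.ofReal_one]
        rw [hU', mul_one, diagonal_mul_diagonal, hd, diagonal_one, mul_one, hU]
  refine ⟨?_, ?_, ?_⟩
  · rw [hspec, Matrix.IsUnit.posDef_star_right_conjugate_iff hUu]
    exact PosDef.diagonal fun j => by exact_mod_cast hz j
  · rw [hinv, trace_mul_comm, ← mul_assoc, hU', one_mul, trace_diagonal, ← Complex.ofReal_sum,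
      Complex.ofReal_re]
  · have : (B + z • 1)⁻¹ * (B + z • 1)⁻¹ = U * diagonal (fun j => (((x j + z)⁻¹ ^ 2 : ℝ) : ℂ)) *
        star U := by
      calc _ = U * (diagonal (fun j => (((x j + z)⁻¹ : ℝ) : ℂ)) * (star U * U) *
            diagonal (fun j => (((x j + z)⁻¹ : ℝ) : ℂ))) * star U := by
              rw [hinv]; simp only [mul_assoc]
        _ = _ := by
          rw [hU', mul_one, diagonal_mul_diagonal]
          simp only [sq, Complex.ofReal_mul]
    rw [this, trace_mul_comm, ← mul_assoc, hU', one_mul, trace_diagonal, ← Complex.ofReal_sum,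
      Complex.ofReal_re]

lemma Matrix.PosSemidef.dotProduct_mulVec_eq_re {n : Type*} [Fintype n] {C : Matrix n n ℂ}
    (hC : C.PosSemidef)
    (v : n → ℂ) : star v ⬝ᵥ C *ᵥ v = ((star v ⬝ᵥ C *ᵥ v).re : ℂ) :=
  Complex.eq_re_of_ofReal_le (r := 0) (by simpa using hC.dotProduct_mulVec_nonneg v)

/-- Sherman–Morrison formula. -/
lemma Matrix.PosDef.add_smul_vecMulVec_mul {n : Type*} [Fintype n] [DecidableEq n]
    {B : Matrix n n ℂ} (hB : B.PosDef) (v : n → ℂ) (t : ℝ)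
    (ht : 1 + t * (star v ⬝ᵥ B⁻¹ *ᵥ v).re ≠ 0) :
    (B + t • vecMulVec v (star v)) * (B⁻¹ - (t / (1 + t * (star v ⬝ᵥ B⁻¹ *ᵥ v).re)) •
      (B⁻¹ * vecMulVec v (star v) * B⁻¹)) = 1 := by
  have hq := hB.inv.posSemidef.dotProduct_mulVec_eq_re v
  set q := (star v ⬝ᵥ B⁻¹ *ᵥ v).re
  set V := vecMulVec v (star v) with hV
  set C := B⁻¹
  have hBC : B * C = 1 := mul_nonsing_inv B ((isUnit_iff_isUnit_det B).1 hB.isUnit)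
  have hVCV : V * C * V = q • V := by
    rw [hV, mul_assoc, mul_vecMulVec, vecMulVec_mul_vecMulVec, hq]
    ext i j
    simp [vecMulVec_apply]
    ring
  set k := t / (1 + t * q)
  have hk : t - k - t * k * q = 0 := by
    simp only [k]; field_simp; ring
  calc _ = B * C + t • (V * C) - k • ((B * C) * V * C) - (t * k) • (V * C * V * C) := by
        simp only [add_mul, mul_sub, mul_smul_comm, smul_mul_assoc, mul_assoc]
        module
    _ = 1 + (t - k - t * k * q) • (V * C) := by
        rw [hBC, hVCV, one_mul, smul_mul_assoc]; module
    _ = 1 := by rw [hk, zero_smul, add_zero]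

lemma trace_mul_vecMulVec_mul {n : Type*} [Fintype n] (C : Matrix n n ℂ) (v : n → ℂ) :
    (C * vecMulVec v (star v) * C).trace = star v ⬝ᵥ (C * C) *ᵥ v := by
  rw [mul_assoc, trace_mul_comm, mul_assoc, vecMulVec_mul, trace_vecMulVec, dotProduct_mulVec,
    dotProduct_comm]


lemma sum_inv_add_sq_le {n : Type*} [Fintype n] [Nonempty n] {x : n → ℝ} (hx : ∀ j, 0 < x j)
    {δ : ℝ} (hδ : 0 < δ) :
    0 < ∑ j, (x j)⁻¹ - ∑ j, (x j + δ)⁻¹ ∧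
      ∑ j, ((x j + δ)⁻¹) ^ 2 ≤ (∑ j, (x j)⁻¹ - ∑ j, (x j + δ)⁻¹) / δ := by
  have hD : ∀ j, (x j)⁻¹ - (x j + δ)⁻¹ = δ * ((x j)⁻¹ * (x j + δ)⁻¹) := fun j => by
    have := hx j
    field_simp
    ring
  have hpos : ∀ j, 0 < (x j)⁻¹ * (x j + δ)⁻¹ := fun j => by
    have := hx j
    positivity
  rw [← Finset.sum_sub_distrib, Finset.sum_congr rfl fun j _ => hD j, ← Finset.mul_sum,
    mul_div_cancel_left₀ _ hδ.ne']
  refine ⟨mul_pos hδ (Finset.sum_pos (fun j _ => hpos j) Finset.univ_nonempty),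
    Finset.sum_le_sum fun j _ => ?_⟩
  have := hx j
  rw [sq]
  gcongr
  linarith

lemma le_sum_inv_sub_one_sq {n : Type*} [Fintype n] [Nonempty n] {x : n → ℝ} (hx : ∀ j, 1 < x j)
    (hsum : ∑ j, (x j)⁻¹ ≤ 1) :
    0 < ∑ j, (x j - 1)⁻¹ - ∑ j, (x j)⁻¹ ∧
      (∑ j, (x j - 1)⁻¹ - ∑ j, (x j)⁻¹) + (∑ j, (x j - 1)⁻¹ - ∑ j, (x j)⁻¹) ^ 2 ≤
        ∑ j, ((x j - 1)⁻¹) ^ 2 := by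
  have hx0 : ∀ j, 0 < x j := fun j => one_pos.trans (hx j)
  have hx1 : ∀ j, 0 < x j - 1 := fun j => sub_pos.2 (hx j)
  have hD : ∀ j, (x j - 1)⁻¹ - (x j)⁻¹ = (x j)⁻¹ * (x j - 1)⁻¹ := fun j => by
    have := (hx0 j).ne'
    have := (hx1 j).ne'
    field_simp
    ring
  have hE : ∀ j, ((x j - 1)⁻¹) ^ 2 = (x j)⁻¹ * (x j - 1)⁻¹ + (x j)⁻¹ * ((x j - 1)⁻¹) ^ 2 :=
      fun j => by
    have := (hx0 j).ne'
    have := (hx1 j).ne'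
    field_simp
    ring
  have hCS : (∑ j, (x j)⁻¹ * (x j - 1)⁻¹) ^ 2 ≤
      (∑ j, (x j)⁻¹) * ∑ j, (x j)⁻¹ * ((x j - 1)⁻¹) ^ 2 := by
    refine Finset.sum_sq_le_sum_mul_sum_of_sq_le_mul _ (fun j _ => ?_) (fun j _ => ?_)
      fun j _ => le_of_eq (by ring)
    · exact (inv_pos.2 (hx0 j)).le
    · have := hx0 j
      positivity
  have hnn : 0 ≤ ∑ j, (x j)⁻¹ * ((x j - 1)⁻¹) ^ 2 := Finset.sum_nonneg fun j _ => by
    have := hx0 j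
    positivity
  rw [← Finset.sum_sub_distrib, Finset.sum_congr rfl fun j _ => hD j,
    Finset.sum_congr rfl fun j _ => hE j, Finset.sum_add_distrib]
  refine ⟨Finset.sum_pos (fun j _ => mul_pos (inv_pos.2 (hx0 j)) (inv_pos.2 (hx1 j)))
    Finset.univ_nonempty, ?_⟩
  nlinarith [mul_le_mul_of_nonneg_right hsum hnn]

lemma Matrix.PosDef.mul_self {n : Type*} [Fintype n] [DecidableEq n] {C : Matrix n n ℂ}
    (hC : C.PosDef) : (C * C).PosDef := by
  have h := PosDef.conjTranspose_mul_self C (mulVec_injective_of_isUnit hC.isUnit)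
  rwa [hC.1.eq] at h

lemma Matrix.PosDef.sub_smul_vecMulVec {n : Type*} [Fintype n] [DecidableEq n] {B : Matrix n n ℂ}
    (hB : B.PosDef) {v : n → ℂ}
    {t φ : ℝ} (ht : 0 < t) (hφ : B⁻¹.trace.re < φ)
    (h : (star v ⬝ᵥ (B⁻¹ * B⁻¹) *ᵥ v).re / (φ - B⁻¹.trace.re) + (star v ⬝ᵥ B⁻¹ *ᵥ v).re ≤ t⁻¹) :
    (B - t • vecMulVec v (star v)).PosDef ∧ (B - t • vecMulVec v (star v))⁻¹.trace.re ≤ φ := by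
  have hCC := hB.inv.mul_self
  have htq : t * (star v ⬝ᵥ B⁻¹ *ᵥ v).re < 1 := by
    rcases eq_or_ne v 0 with rfl | hv
    · simp
    · have hp := hCC.re_dotProduct_pos hv
      have : (star v ⬝ᵥ B⁻¹ *ᵥ v).re < t⁻¹ :=
        (lt_add_of_pos_left _ (div_pos hp (sub_pos.2 hφ))).trans_le h
      calc _ < t * t⁻¹ := by gcongr
        _ = 1 := mul_inv_cancel₀ ht.ne'
  have hp := hCC.posSemidef.re_dotProduct_nonneg v
  have hmul := hB.add_smul_vecMulVec_mul v (-t) (by linarith)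
  set q := (star v ⬝ᵥ B⁻¹ *ᵥ v).re
  rw [neg_smul, ← sub_eq_add_neg] at hmul
  have hk : 0 < t / (1 - t * q) := div_pos ht (by linarith)
  have hk' : -t / (1 + -t * q) = - (t / (1 - t * q)) := by rw [neg_div]; ring_nf
  rw [hk', neg_smul, sub_neg_eq_add] at hmul
  have hinv := inv_eq_right_inv hmul
  constructor
  · rw [← posDef_inv_iff, hinv]
    refine hB.inv.add_posSemidef (PosSemidef.smul ?_ hk.le)
    have := (posSemidef_vecMulVec_self_star v).mul_mul_conjTranspose_same B⁻¹
    rwa [hB.inv.1.eq] at this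
  · rw [hinv, trace_add, trace_smul, trace_mul_vecMulVec_mul, Complex.add_re, Complex.smul_re]
    change 0 ≤ (star v ⬝ᵥ (B⁻¹ * B⁻¹) *ᵥ v).re at hp
    set p := (star v ⬝ᵥ (B⁻¹ * B⁻¹) *ᵥ v).re
    have hd := sub_pos.2 hφ
    have h1 : p / (φ - B⁻¹.trace.re) ≤ t⁻¹ - q := by linarith
    rw [div_le_iff₀ hd] at h1
    have h2 : t / (1 - t * q) * p ≤ φ - B⁻¹.trace.re := by
      have : 0 < 1 - t * q := by linarith
      rw [div_mul_eq_mul_div, div_le_iff₀ this]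
      calc t * p ≤ t * ((t⁻¹ - q) * (φ - B⁻¹.trace.re)) := by gcongr
        _ = _ := by field_simp
    simp only [smul_eq_mul]
    linarith

lemma Matrix.PosDef.add_smul_vecMulVec_s3 {n : Type*} [Fintype n] [DecidableEq n] {B : Matrix n n ℂ}
    (hB : B.PosDef) {v : n → ℂ}
    {t φ : ℝ} (ht : 0 < t) (hφ : φ < B⁻¹.trace.re)
    (h : t⁻¹ ≤ (star v ⬝ᵥ (B⁻¹ * B⁻¹) *ᵥ v).re / (B⁻¹.trace.re - φ) - (star v ⬝ᵥ B⁻¹ *ᵥ v).re) :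
    (B + t • vecMulVec v (star v)).PosDef ∧ (B + t • vecMulVec v (star v))⁻¹.trace.re ≤ φ := by
  refine ⟨hB.add_posSemidef ((posSemidef_vecMulVec_self_star v).smul ht.le), ?_⟩
  have hq : 0 ≤ (star v ⬝ᵥ B⁻¹ *ᵥ v).re := hB.inv.posSemidef.re_dotProduct_nonneg v
  have hpos : 0 < 1 + t * (star v ⬝ᵥ B⁻¹ *ᵥ v).re := by positivity
  rw [inv_eq_right_inv (hB.add_smul_vecMulVec_mul v t hpos.ne'), trace_sub, trace_smul,
    trace_mul_vecMulVec_mul, Complex.sub_re, Complex.smul_re]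
  set q := (star v ⬝ᵥ B⁻¹ *ᵥ v).re
  set p := (star v ⬝ᵥ (B⁻¹ * B⁻¹) *ᵥ v).re
  have hd := sub_pos.2 hφ
  have h1 : t⁻¹ + q ≤ p / (B⁻¹.trace.re - φ) := by linarith
  rw [le_div_iff₀ hd] at h1
  have h2 : B⁻¹.trace.re - φ ≤ t / (1 + t * q) * p := by
    rw [div_mul_eq_mul_div, le_div_iff₀ hpos]
    calc _ = t * ((t⁻¹ + q) * (B⁻¹.trace.re - φ)) := by field_simp
      _ ≤ _ := by gcongr
  simp only [smul_eq_mul]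
  linarith

lemma sum_dotProduct_mulVec_eq_trace {n : Type*} [Fintype n] [DecidableEq n]
    {ι : Type*} [Fintype ι] {v : ι → n → ℂ}
    (hv : ∑ i, vecMulVec (v i) (star (v i)) = 1) (C : Matrix n n ℂ) :
    ∑ i, (star (v i) ⬝ᵥ C *ᵥ v i).re = C.trace.re := by
  rw [← Complex.re_sum]
  congr 1
  calc _ = ∑ i, (C * vecMulVec (v i) (star (v i))).trace := by
        simp only [mul_vecMulVec, trace_vecMulVec, dotProduct_comm]
    _ = C.trace := by rw [← trace_sum, ← Finset.mul_sum, hv, mul_one]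

/-- One rank-one update lets the upper barrier move by `δ` and the lower barrier by `1` without
increasing either potential. -/
lemma exists_barrier_step {n : Type*} [Fintype n] [DecidableEq n] [Nonempty n]
    {ι : Type*} [Fintype ι] {v : ι → n → ℂ}
    (hv : ∑ i, vecMulVec (v i) (star (v i)) = 1) {c δ : ℝ} (hc : 1 < c)
    (hδ : δ = (c + 1) / (c - 1)) {A : Matrix n n ℂ} {u l : ℝ}
    (hu : (u • 1 - A).PosDef) (hl : (A - l • 1).PosDef)
    (hut : (u • 1 - A)⁻¹.trace.re ≤ (δ * c)⁻¹) (hlt : (A - l • 1)⁻¹.trace.re ≤ c⁻¹) :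
    ∃ i, ∃ t : ℝ, 0 < t ∧
      ((u + δ) • 1 - (A + t • vecMulVec (v i) (star (v i)))).PosDef ∧
      ((A + t • vecMulVec (v i) (star (v i))) - (l + 1) • 1).PosDef ∧
      ((u + δ) • 1 - (A + t • vecMulVec (v i) (star (v i))))⁻¹.trace.re ≤ (δ * c)⁻¹ ∧
      ((A + t • vecMulVec (v i) (star (v i))) - (l + 1) • 1)⁻¹.trace.re ≤ c⁻¹ := by
  have hδ0 : 0 < δ := hδ ▸ div_pos (by linarith) (by linarith)
  have hc0 : 0 < c := by linarith
  obtain ⟨x, hx, hxz⟩ := hu.exists_trace_inv_add_smul_one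
  obtain ⟨w, hw, hwz⟩ := hl.exists_trace_inv_add_smul_one
  obtain ⟨-, hx0, -⟩ := hxz 0 (by simpa using hx)
  obtain ⟨hU, hx1, hx2⟩ := hxz δ fun j => add_pos (hx j) hδ0
  obtain ⟨-, hw0, -⟩ := hwz 0 (by simpa using hw)
  simp only [zero_smul, add_zero] at hx0 hw0
  have hc1 : c⁻¹ < 1 := inv_lt_one_of_one_lt₀ hc
  have hw1 : ∀ j, 1 < w j := fun j => by
    have : (w j)⁻¹ ≤ ∑ j, (w j)⁻¹ :=
      Finset.single_le_sum (f := fun j => (w j)⁻¹) (fun j _ => (inv_pos.2 (hw j)).le)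
        (Finset.mem_univ j)
    rw [← inv_lt_one₀ (hw j)]
    linarith
  obtain ⟨hL, hwt, hw2⟩ := hwz (-1) fun j => by linarith [hw1 j]
  obtain ⟨hDU, hPU⟩ := sum_inv_add_sq_le hx hδ0
  obtain ⟨hDL, hPL⟩ := le_sum_inv_sub_one_sq hw1 (by linarith)
  simp only [← sub_eq_add_neg] at hwt hw2
  rw [← hx0, ← hx1] at hDU hPU
  rw [← hx2] at hPU
  rw [← hw0, ← hwt] at hDL hPL
  rw [← hw2] at hPL
  set BU := u • 1 - A + δ • 1
  set BL := A - l • 1 + (-1 : ℝ) • 1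
  set φU := (u • 1 - A)⁻¹.trace.re
  set φL := (A - l • 1)⁻¹.trace.re
  have hCC := hU.inv.mul_self
  let fU : ι → ℝ := fun i => (star (v i) ⬝ᵥ (BU⁻¹ * BU⁻¹) *ᵥ v i).re / (φU - BU⁻¹.trace.re) +
    (star (v i) ⬝ᵥ BU⁻¹ *ᵥ v i).re
  let fL : ι → ℝ := fun i => (star (v i) ⬝ᵥ (BL⁻¹ * BL⁻¹) *ᵥ v i).re / (BL⁻¹.trace.re - φL) -
    (star (v i) ⬝ᵥ BL⁻¹ *ᵥ v i).re
  have hsU : ∑ i, fU i ≤ 1 - c⁻¹ := by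
    simp only [fU, Finset.sum_add_distrib, ← Finset.sum_div, sum_dotProduct_mulVec_eq_trace hv]
    have h1 : (BU⁻¹ * BU⁻¹).trace.re / (φU - BU⁻¹.trace.re) ≤ δ⁻¹ := by
      rw [div_le_iff₀ hDU, inv_mul_eq_div]
      exact hPU
    have h2 : δ⁻¹ + (δ * c)⁻¹ = 1 - c⁻¹ := by
      have : c - 1 ≠ 0 := by linarith
      have : c + 1 ≠ 0 := by linarith
      rw [hδ]
      field_simp
    linarith
  have hsL : 1 - c⁻¹ ≤ ∑ i, fL i := by
    simp only [fL, Finset.sum_sub_distrib, ← Finset.sum_div, sum_dotProduct_mulVec_eq_trace hv]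
    have h1 : 1 + (BL⁻¹.trace.re - φL) ≤
        (BL⁻¹ * BL⁻¹).trace.re / (BL⁻¹.trace.re - φL) := by
      rw [le_div_iff₀ hDL]
      linarith
    linarith
  have hfU : ∀ i, v i ≠ 0 → 0 < fU i := fun i hi =>
    add_pos (div_pos (hCC.re_dotProduct_pos hi) hDU) (hU.inv.re_dotProduct_pos hi)
  obtain ⟨i, hi0, hi⟩ : ∃ i, v i ≠ 0 ∧ fU i ≤ fL i := by
    by_contra! hcon
    have hle : ∀ i ∈ Finset.univ, fL i ≤ fU i := fun i _ => by
      by_cases hi : v i = 0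
      · simp [fL, fU, hi]
      · exact (hcon i hi).le
    obtain ⟨i, hi⟩ : ∃ i, v i ≠ 0 := by
      by_contra! h0
      simp [h0] at hv
    exact absurd (Finset.sum_lt_sum hle ⟨i, Finset.mem_univ i, hcon i hi⟩) (by linarith)
  have ht := hfU i hi0
  obtain ⟨h1, h2⟩ := hU.sub_smul_vecMulVec (inv_pos.2 ht) (sub_pos.1 hDU) (inv_inv (fU i)).ge
  obtain ⟨h3, h4⟩ := hL.add_smul_vecMulVec_s3 (v := v i) (inv_pos.2 ht) (sub_pos.1 hDL)
    ((inv_inv (fU i)).le.trans hi)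
  have e1 : (u + δ) • 1 - (A + (fU i)⁻¹ • vecMulVec (v i) (star (v i))) =
      BU - (fU i)⁻¹ • vecMulVec (v i) (star (v i)) := by
    simp only [BU]; module
  have e2 : (A + (fU i)⁻¹ • vecMulVec (v i) (star (v i))) - (l + 1) • 1 =
      BL + (fU i)⁻¹ • vecMulVec (v i) (star (v i)) := by
    simp only [BL]; module
  refine ⟨i, (fU i)⁻¹, inv_pos.2 ht, ?_⟩
  rw [e1, e2]
  exact ⟨h1, h3, h2.trans hut, h4.trans hlt⟩

/-- After `k` rank-one updates the spectrum lies between the barriers `k - dc` and `δ(k + dc)`,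
where `d` is the dimension. -/
lemma exists_barrier_weights {n : Type*} [Fintype n] [DecidableEq n] [Nonempty n] {ι : Type*}
    [Fintype ι] {v : ι → n → ℂ} (hv : ∑ i, vecMulVec (v i) (star (v i)) = 1) {c δ : ℝ} (hc : 1 < c)
    (hδ : δ = (c + 1) / (c - 1)) (k : ℕ) :
    ∃ s : ι → ℝ, (∀ i, 0 ≤ s i) ∧ (Finset.univ.filter fun i => s i ≠ 0).card ≤ k ∧
      ((δ * (k + Fintype.card n * c)) • 1 - ∑ i, s i • vecMulVec (v i) (star (v i))).PosDef ∧
      (∑ i, s i • vecMulVec (v i) (star (v i)) - (k - Fintype.card n * c : ℝ) • 1).PosDef ∧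
      ((δ * (k + Fintype.card n * c)) • 1 -
        ∑ i, s i • vecMulVec (v i) (star (v i)))⁻¹.trace.re ≤ (δ * c)⁻¹ ∧
      (∑ i, s i • vecMulVec (v i) (star (v i)) -
        (k - Fintype.card n * c : ℝ) • 1)⁻¹.trace.re ≤ c⁻¹ := by
  classical
  have hδ0 : 0 < δ := hδ ▸ div_pos (by linarith) (by linarith)
  have hc0 : 0 < c := by linarith
  have hn : (0 : ℝ) < Fintype.card n := by exact_mod_cast Fintype.card_pos
  induction k with
  | zero =>
    have key : ∀ z : ℝ, 0 < z → (z • (1 : Matrix n n ℂ)).PosDef ∧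
        (z • (1 : Matrix n n ℂ))⁻¹.trace.re = Fintype.card n * z⁻¹ := fun z hz => by
      have hinv : (z • (1 : Matrix n n ℂ))⁻¹ = z⁻¹ • 1 := inv_eq_right_inv <| by
        rw [smul_mul_smul_comm, mul_one, mul_inv_cancel₀ hz.ne', one_smul]
      refine ⟨PosDef.one.smul hz, ?_⟩
      rw [hinv, trace_smul, trace_one, Complex.smul_re, Complex.natCast_re, smul_eq_mul, mul_comm]
    obtain ⟨h1, h2⟩ := key (δ * (Fintype.card n * c)) (by positivity)
    obtain ⟨h3, h4⟩ := key (Fintype.card n * c) (by positivity)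
    refine ⟨0, fun i => le_rfl, by simp, ?_, ?_, ?_, ?_⟩
    · simpa using h1
    · simpa using h3
    · simp only [Nat.cast_zero, zero_add, Pi.zero_apply, zero_smul, Finset.sum_const_zero, sub_zero,
        h2]
      apply le_of_eq
      field_simp
    · simp only [Nat.cast_zero, zero_sub, Pi.zero_apply, zero_smul, Finset.sum_const_zero,
        neg_smul, neg_neg, h4]
      apply le_of_eq
      field_simp
  | succ k ih =>
    obtain ⟨s, hs, hcard, h1, h2, h3, h4⟩ := ih
    obtain ⟨i, t, ht, h1, h2, h3, h4⟩ := exists_barrier_step hv hc hδ h1 h2 h3 h4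
    have hsum : ∑ j, (s + Pi.single i t : ι → ℝ) j • vecMulVec (v j) (star (v j)) =
        ∑ j, s j • vecMulVec (v j) (star (v j)) + t • vecMulVec (v i) (star (v i)) := by
      simp only [Pi.add_apply, add_smul, Finset.sum_add_distrib, Pi.single_apply, ite_smul,
        zero_smul, Finset.sum_ite_eq', Finset.mem_univ, if_true]
    have hu : δ * ((k + 1 : ℕ) + Fintype.card n * c) = δ * (k + Fintype.card n * c) + δ := by
      push_cast; ring
    have hl : ((k + 1 : ℕ) - Fintype.card n * c : ℝ) = k - Fintype.card n * c + 1 := by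
      push_cast; ring
    refine ⟨s + Pi.single i t, fun j => add_nonneg (hs j) ?_, ?_, ?_⟩
    · exact (Pi.single_nonneg.2 ht.le : 0 ≤ (Pi.single i t : ι → ℝ)) j
    · calc _ ≤ (insert i (Finset.univ.filter fun i => s i ≠ 0)).card := by
            refine Finset.card_le_card fun j hj => ?_
            by_cases hji : j = i
            · simp [hji]
            · simpa [hji] using hj
        _ ≤ k + 1 := (Finset.card_insert_le _ _).trans (by lia)
    · rw [hsum, hu, hl]
      exact ⟨h1, h2, h3, h4⟩

lemma dotProduct_sum_smul_vecMulVec_mulVec {n : Type*} [Fintype n] {ι : Type*} [Fintype ι]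
    (v : ι → n → ℂ) (s : ι → ℝ) (a : n → ℂ) :
    (star a ⬝ᵥ (∑ i, s i • vecMulVec (v i) (star (v i))) *ᵥ a).re =
      ∑ i, s i * ‖star (v i) ⬝ᵥ a‖ ^ 2 := by
  rw [sum_mulVec, dotProduct_sum, Complex.re_sum]
  refine Finset.sum_congr rfl fun i _ => ?_
  have h : star a ⬝ᵥ v i = star (star (v i) ⬝ᵥ a) := by
    rw [← star_dotProduct_star, star_star, dotProduct_comm]
  rw [smul_mulVec, dotProduct_smul, Complex.smul_re, vecMulVec_mulVec, smul_eq_mul]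
  congr 1
  rw [dotProduct_smul, h, MulOpposite.smul_eq_mul_unop, MulOpposite.unop_op, Complex.star_def,
    ← Complex.normSq_eq_conj_mul_self, Complex.ofReal_re, Complex.normSq_eq_norm_sq]

/-- The Batson–Spielman–Srivastava theorem for a Parseval frame. -/
theorem exists_sparse_weights_of_sum_vecMulVec_eq_one {n : Type*} [Fintype n] [DecidableEq n]
    {ι : Type*} [Fintype ι] {v : ι → n → ℂ} (hv : ∑ i, vecMulVec (v i) (star (v i)) = 1)
    {b : ℝ} (hb : 1 < b) {N : ℕ} (hN : b * Fintype.card n ≤ N) :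
    ∃ s : ι → ℝ, (∀ i, 0 ≤ s i) ∧ (Finset.univ.filter fun i => s i ≠ 0).card ≤ N ∧
      ∀ a : n → ℂ,
        ∑ i, ‖star (v i) ⬝ᵥ a‖ ^ 2 ≤ ∑ i, s i * ‖star (v i) ⬝ᵥ a‖ ^ 2 ∧
        ∑ i, s i * ‖star (v i) ⬝ᵥ a‖ ^ 2 ≤
          (√b + 1) ^ 2 / (√b - 1) ^ 2 * ∑ i, ‖star (v i) ⬝ᵥ a‖ ^ 2 := by
  rcases isEmpty_or_nonempty n with hn | hn
  · exact ⟨0, fun i => le_rfl, by simp, fun a => by simp [Matrix.dotProduct_of_isEmpty]⟩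
  have hc : 1 < √b := by rwa [Real.lt_sqrt zero_le_one, one_pow]
  have hcb : √b ^ 2 = b := Real.sq_sqrt (by linarith)
  rw [← hcb] at hN
  generalize √b = c at hc hN
  have hn0 : (0 : ℝ) < Fintype.card n := by exact_mod_cast Fintype.card_pos
  have hc1 : 0 < c - 1 := sub_pos.2 hc
  obtain ⟨s, hs, hcard, hU, hL, -, -⟩ := exists_barrier_weights hv hc rfl N
  set l : ℝ := N - Fintype.card n * c with hl
  set u : ℝ := (c + 1) / (c - 1) * (N + Fintype.card n * c) with hu
  have hl0 : 0 < l := by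
    have : Fintype.card n * c < c ^ 2 * Fintype.card n := by nlinarith [mul_pos hn0 hc1]
    linarith
  refine ⟨fun i => l⁻¹ * s i, fun i => mul_nonneg (inv_pos.2 hl0).le (hs i), ?_, fun a => ?_⟩
  · simpa [hl0.ne'] using hcard
  have hq := dotProduct_sum_smul_vecMulVec_mulVec v (fun _ => 1) a
  simp only [one_smul, one_mul, hv, one_mulVec] at hq
  have hA := dotProduct_sum_smul_vecMulVec_mulVec v s a
  have hU' : 0 ≤ (star a ⬝ᵥ _ *ᵥ a).re := hU.posSemidef.re_dotProduct_nonneg a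
  have hL' : 0 ≤ (star a ⬝ᵥ _ *ᵥ a).re := hL.posSemidef.re_dotProduct_nonneg a
  simp only [sub_mulVec, smul_mulVec, one_mulVec, dotProduct_sub, dotProduct_smul, Complex.sub_re,
    Complex.smul_re, smul_eq_mul, hq, hA] at hU' hL'
  have hq0 : 0 ≤ ∑ i, ‖star (v i) ⬝ᵥ a‖ ^ 2 := Finset.sum_nonneg fun i _ => by positivity
  simp only [mul_assoc, ← Finset.mul_sum]
  constructor
  · rw [le_inv_mul_iff₀ hl0]
    linarith
  · rw [inv_mul_le_iff₀ hl0]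
    have hul : u ≤ l * ((c + 1) ^ 2 / (c - 1) ^ 2) := by
      calc u = (c + 1) / (c - 1) ^ 2 * ((c - 1) * (N + Fintype.card n * c)) := by
            rw [hu]; field_simp
        _ ≤ (c + 1) / (c - 1) ^ 2 * ((c + 1) * l) := by
            refine mul_le_mul_of_nonneg_left ?_ (div_nonneg (by linarith) (sq_nonneg _))
            rw [hl]
            nlinarith
        _ = _ := by ring
    nlinarith [mul_le_mul_of_nonneg_right hul hq0]

/-- Every finite family of vectors factors through a Parseval frame. -/
lemma exists_parseval_factorization {m M : ℕ} (y : Fin M → Fin m → ℂ) :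
    ∃ r ≤ m, ∃ v : Fin M → Fin r → ℂ, ∑ i, vecMulVec (v i) (star (v i)) = 1 ∧
      ∀ a : Fin m → ℂ, ∃ w : Fin r → ℂ, ∀ i, star (y i) ⬝ᵥ a = star (v i) ⬝ᵥ w := by
  let T : (Fin m → ℂ) →ₗ[ℂ] EuclideanSpace ℂ (Fin M) :=
    (WithLp.linearEquiv 2 ℂ (Fin M → ℂ)).symm.toLinearMap ∘ₗ
      (Matrix.of fun i => star (y i)).mulVecLin
  have hT : ∀ a i, T a i = star (y i) ⬝ᵥ a := fun a i => rfl
  let e := stdOrthonormalBasis ℂ (LinearMap.range T)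
  refine ⟨_, ?_, fun i j => star ((e j : EuclideanSpace ℂ (Fin M)) i), ?_, fun a => ?_⟩
  · exact T.finrank_range_le.trans (by simp)
  · ext j k
    have h := orthonormal_iff_ite.1 e.orthonormal j k
    rw [Submodule.coe_inner, PiLp.inner_apply] at h
    rw [Matrix.sum_apply, one_apply, ← h]
    refine Finset.sum_congr rfl fun i _ => ?_
    simp [vecMulVec_apply, mul_comm]
  · refine ⟨e.repr ⟨T a, LinearMap.mem_range_self T a⟩, fun i => ?_⟩
    have h := congrArg Subtype.val (e.sum_repr ⟨T a, LinearMap.mem_range_self T a⟩)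
    have h := congrArg (fun x : EuclideanSpace ℂ (Fin M) => x i) h
    rw [← hT, ← h]
    simp only [Submodule.coe_sum, Submodule.coe_smul, WithLp.ofLp_sum, Finset.sum_apply,
      PiLp.smul_apply, smul_eq_mul, dotProduct, Pi.star_apply, star_star]
    exact Finset.sum_congr rfl fun j _ => mul_comm _ _

/-- Weighted subsampling with preconditioning (BSS⊥), inequality (auxweightedestimate1). -/
theorem stmt_3 (m M : ℕ) (hMm : m ≤ M) (y : Fin M → Fin m → ℂ) (b : ℝ) (hb : 1 < b) :
    ∃ s : Fin M → ℝ, (∀ i, 0 ≤ s i) ∧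
      (Finset.univ.filter fun i => s i ≠ 0).card ≤ ⌈b * m⌉₊ ∧
      ∀ a : Fin m → ℂ,
        ∑ i, ‖star (y i) ⬝ᵥ a‖ ^ 2 ≤ ∑ i, s i * ‖star (y i) ⬝ᵥ a‖ ^ 2 ∧
        ∑ i, s i * ‖star (y i) ⬝ᵥ a‖ ^ 2 ≤
          (Real.sqrt b + 1) ^ 2 / (Real.sqrt b - 1) ^ 2 *
            ∑ i, ‖star (y i) ⬝ᵥ a‖ ^ 2 := by
  obtain ⟨r, hr, v, hv, hy⟩ := exists_parseval_factorization y
  have hN : b * Fintype.card (Fin r) ≤ ⌈b * m⌉₊ := by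
    refine le_trans ?_ (Nat.le_ceil _)
    rw [Fintype.card_fin]
    gcongr
  obtain ⟨s, hs, hcard, h⟩ := exists_sparse_weights_of_sum_vecMulVec_eq_one hv hb hN
  refine ⟨s, hs, hcard, fun a => ?_⟩
  obtain ⟨w, hw⟩ := hy a
  simpa only [hw] using h w
end

section
/- Let $(y^i)_{i=1}^M \subset \mathbb{C}^m$ be a frame with bounds $0 < A_0 \le B_0 < \infty$ and let $\kappa := (\frac{B_0}{2A_0} + \frac{1}{2}) + \sqrt{(\frac{B_0}{2A_0} + \frac{1}{2})^2 - 1}$. Let $A \in \mathbb{C}^{m \times m}$ be Hermitian with all eigenvalues in the open interval $(l, u)$ for $l, u \in \mathbb{R}$. Suppose $\delta_L, \delta_U, \epsilon_L, \epsilon_U > 0$ satisfy $0 < \frac{B_0}{A_0}(\frac{1}{\delta_U} + \epsilon_U) \le \frac{1}{\delta_L} - \kappa \epsilon_L$, $\epsilon_L \ge \Phi_l(A)$, and $\epsilon_U \ge \Phi^u(A)$. Then there exists an index $i \in \{1, \dots, M\}$ such that $L_A(y^i; l, \delta_L) \ge U_A(y^i; u, \delta_U)$ (and then both are positive); moreover,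 for any such index $i$ and any $t > 0$ with $L_A(y^i; l, \delta_L) \ge 1/t \ge U_A(y^i; u, \delta_U)$, the matrix $A' := A + t\, y^i (y^i)^*$ satisfies: all eigenvalues of $A'$ lie in $(l + \delta_L, u + \delta_U)$, $\Phi_{l+\delta_L}(A') \le \Phi_l(A)$, and $\Phi^{u+\delta_U}(A') \le \Phi^u(A)$. -/
open Matrix

/-- Smallest point of the (real) spectrum of a complex matrix. For a Hermitian
matrix this is the smallest eigenvalue `λ_min`. -/
noncomputable def specMin {m : ℕ} (A : Matrix (Fin m) (Fin m) ℂ) : ℝ :=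
  sInf {x : ℝ | (x : ℂ) ∈ spectrum ℂ A}

/-- Largest point of the (real) spectrum of a complex matrix. For a Hermitian
matrix this is the largest eigenvalue `λ_max`. -/
noncomputable def specMax {m : ℕ} (A : Matrix (Fin m) (Fin m) ℂ) : ℝ :=
  sSup {x : ℝ | (x : ℂ) ∈ spectrum ℂ A}

/-- Lower potential `Φ_l(A) = tr((A - l·I)⁻¹) = ∑ᵢ (λᵢ - l)⁻¹` (real-valued for
Hermitian `A` when `l` is not an eigenvalue). -/
noncomputable def lowPot {m : ℕ} (A : Matrix (Fin m) (Fin m) ℂ) (l : ℝ) : ℝ :=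
  (Matrix.trace (A - (l : ℂ) • 1)⁻¹).re

/-- Upper potential `Φ^u(A) = tr((u·I - A)⁻¹) = ∑ᵢ (u - λᵢ)⁻¹`. -/
noncomputable def upPot {m : ℕ} (A : Matrix (Fin m) (Fin m) ℂ) (u : ℝ) : ℝ :=
  (Matrix.trace ((u : ℂ) • 1 - A)⁻¹).re

/-- `L_A(v; l, δ)` from (LA), for `δ ≠ 0`. -/
noncomputable def LA {m : ℕ} (A : Matrix (Fin m) (Fin m) ℂ) (v : Fin m → ℂ)
    (l δ : ℝ) : ℝ :=
  (star v ⬝ᵥ ((A - ((l + δ : ℝ) : ℂ) • 1)⁻¹ ^ 2).mulVec v).re /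
      (lowPot A (l + δ) - lowPot A l)
    - (star v ⬝ᵥ ((A - ((l + δ : ℝ) : ℂ) • 1)⁻¹).mulVec v).re

/-- `U_A(v; u, δ)` from (UA), for `δ ≠ 0`. -/
noncomputable def UA {m : ℕ} (A : Matrix (Fin m) (Fin m) ℂ) (v : Fin m → ℂ)
    (u δ : ℝ) : ℝ :=
  (star v ⬝ᵥ ((((u + δ : ℝ) : ℂ) • 1 - A)⁻¹ ^ 2).mulVec v).re /
      (upPot A u - upPot A (u + δ))
    + (star v ⬝ᵥ ((((u + δ : ℝ) : ℂ) • 1 - A)⁻¹).mulVec v).re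

section RealSums

variable {ι : Type*} [Fintype ι]

lemma sum_mul_pos_of_sum_pos {w c : ι → ℝ} (hw : ∀ j, 0 < w j) (hc : ∀ j, 0 ≤ c j)
    (h : 0 < ∑ j, c j) : 0 < ∑ j, w j * c j := by
  obtain ⟨j, hj, hcj⟩ : ∃ j ∈ Finset.univ, 0 < c j := by
    by_contra! hne
    exact h.not_ge (Finset.sum_nonpos hne)
  exact Finset.sum_pos' (fun k _ => mul_nonneg (hw k).le (hc k)) ⟨j, hj, mul_pos (hw j) hcj⟩

lemma sum_inv_lt_sum_inv [Nonempty ι] {a b : ι → ℝ} (ha : ∀ j, 0 < a j) (h : ∀ j, a j < b j) :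
    ∑ j, (b j)⁻¹ < ∑ j, (a j)⁻¹ :=
  Finset.sum_lt_sum_of_nonempty Finset.univ_nonempty fun j _ => inv_strictAnti₀ (ha j) (h j)

/-- Upper barrier estimate, averaged against weights bounded by `B`. -/
lemma upper_barrier_sum_le_s8 [Nonempty ι] {a b f : ι → ℝ} {δ B : ℝ} (hδ : 0 < δ)
    (ha : ∀ j, 0 < a j) (hb : ∀ j, b j = a j + δ) (hf : ∀ j, 0 ≤ f j) (hfB : ∀ j, f j ≤ B) :
    (∑ j, ((b j)⁻¹ * (b j)⁻¹) * f j) / (∑ j, (a j)⁻¹ - ∑ j, (b j)⁻¹) + ∑ j, (b j)⁻¹ * f j ≤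
      B * (1 / δ + ∑ j, (a j)⁻¹) := by
  have hb0 : ∀ j, 0 < b j := fun j => by rw [hb]; linarith [ha j]
  have hab : ∀ j, a j < b j := fun j => by rw [hb]; linarith
  have hD : 0 < ∑ j, (a j)⁻¹ - ∑ j, (b j)⁻¹ := sub_pos.2 (sum_inv_lt_sum_inv ha hab)
  have hba : ∀ j, (b j)⁻¹ ≤ (a j)⁻¹ := fun j => (inv_strictAnti₀ (ha j) (hab j)).le
  have hB : 0 ≤ B := (hf (Classical.arbitrary ι)).trans (hfB _)
  have h₁ : (∑ j, ((b j)⁻¹ * (b j)⁻¹) * f j) / (∑ j, (a j)⁻¹ - ∑ j, (b j)⁻¹) ≤ B * (1 / δ) := by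
    rw [div_le_iff₀ hD, ← Finset.sum_sub_distrib, Finset.mul_sum]
    refine Finset.sum_le_sum fun j _ => ?_
    have hid : 1 / δ * ((a j)⁻¹ - (b j)⁻¹) = (a j)⁻¹ * (b j)⁻¹ := by
      have := (ha j).ne'
      have := (hb0 j).ne'
      field_simp
      rw [hb]
      ring
    rw [mul_assoc B, hid, mul_comm]
    have hb' := (inv_pos.2 (hb0 j)).le
    exact mul_le_mul (hfB j) (mul_le_mul_of_nonneg_right (hba j) hb') (mul_nonneg hb' hb') hB
  have h₂ : ∑ j, (b j)⁻¹ * f j ≤ B * ∑ j, (a j)⁻¹ := by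
    rw [Finset.mul_sum]
    refine Finset.sum_le_sum fun j _ => ?_
    rw [mul_comm]
    exact mul_le_mul (hfB j) (hba j) (inv_pos.2 (hb0 j)).le hB
  linarith

/-- Lower barrier estimate, averaged against weights between `A` and `A * κ`. -/
lemma le_lower_barrier_sum_s8 [Nonempty ι] {a b f : ι → ℝ} {δ A κ : ℝ} (hδ : 0 < δ) (hA : 0 < A)
    (hb0 : ∀ j, 0 < b j) (hb : ∀ j, b j = a j - δ) (hf : ∀ j, A ≤ f j)
    (hfκ : ∀ j, f j ≤ A * κ) (hκ : κ * ∑ j, (a j)⁻¹ ≤ 1 / δ) :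
    A * (1 / δ - κ * ∑ j, (a j)⁻¹) ≤
      (∑ j, ((b j)⁻¹ * (b j)⁻¹) * f j) / (∑ j, (b j)⁻¹ - ∑ j, (a j)⁻¹) -
        ∑ j, (b j)⁻¹ * f j := by
  have hab : ∀ j, b j < a j := fun j => by rw [hb]; linarith
  have ha0 : ∀ j, 0 < a j := fun j => (hb0 j).trans (hab j)
  set D := ∑ j, (b j)⁻¹ - ∑ j, (a j)⁻¹ with hDdef
  have hD : 0 < D := sub_pos.2 (sum_inv_lt_sum_inv hb0 hab)
  have hid : ∀ j, (b j)⁻¹ - (a j)⁻¹ = δ * ((a j)⁻¹ * (b j)⁻¹) := fun j => by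
    have := (ha0 j).ne'
    have := (hb0 j).ne'
    field_simp
    rw [hb]
    ring
  have hDsum : D = δ * ∑ j, (a j)⁻¹ * (b j)⁻¹ := by
    rw [hDdef, ← Finset.sum_sub_distrib, Finset.mul_sum]
    exact Finset.sum_congr rfl fun j _ => hid j
  have hpt : ∀ j, A * (1 + δ * D) * ((a j)⁻¹ * (b j)⁻¹ - κ * D * (a j)⁻¹) ≤
      ((b j)⁻¹ * (b j)⁻¹) * f j - D * ((b j)⁻¹ * f j) := fun j => by
    have hα : 0 < (a j)⁻¹ := inv_pos.2 (ha0 j)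
    have hβ : 0 < (b j)⁻¹ := inv_pos.2 (hb0 j)
    have hαβ := hid j
    have hfj := hf j
    have hfκj := hfκ j
    generalize (a j)⁻¹ = α at *
    generalize (b j)⁻¹ = β at *
    generalize f j = g at *
    have h₁ : 0 ≤ (g - A) * β + (A * κ - g) * D :=
      add_nonneg (mul_nonneg (by linarith) hβ.le) (mul_nonneg (by linarith) hD.le)
    have h₂ : 0 ≤ g * (β - D) ^ 2 + (g - A) * (D * β) + (A * κ - g) * D ^ 2 :=
      add_nonneg (add_nonneg (mul_nonneg (by linarith) (sq_nonneg _))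
        (mul_nonneg (by linarith) (mul_pos hD hβ).le)) (mul_nonneg (by linarith) (sq_nonneg _))
    have h₃ := mul_nonneg hα.le (add_nonneg h₁ (mul_nonneg hδ.le h₂))
    have h₄ : β * β * g - D * (β * g) = (α + δ * (α * β)) * ((β - D) * g) := by
      rw [← hαβ]; ring
    rw [h₄]
    linarith
  have hsum := Finset.sum_le_sum fun j (_ : j ∈ Finset.univ) => hpt j
  rw [← Finset.mul_sum, Finset.sum_sub_distrib, Finset.sum_sub_distrib, ← Finset.mul_sum,
    ← Finset.mul_sum] at hsum
  have hS : ∑ j, (a j)⁻¹ * (b j)⁻¹ = 1 / δ * D := by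
    rw [hDsum]; field_simp
  rw [hS] at hsum
  have hgap : 0 ≤ A * (δ * D) * (D * (1 / δ - κ * ∑ j, (a j)⁻¹)) :=
    mul_nonneg (by positivity) (mul_nonneg hD.le (by linarith))
  rw [le_sub_iff_add_le, le_div_iff₀ hD]
  linarith

end RealSums

namespace Matrix

lemma isHermitian_add_smul_vecMulVec {n : Type*} {A : Matrix n n ℂ} (hA : A.IsHermitian) (t : ℝ)
    (v : n → ℂ) : (A + (t : ℂ) • vecMulVec v (star v)).IsHermitian := by
  refine hA.add ?_
  rw [IsHermitian, conjTranspose_smul, conjTranspose_vecMulVec, star_star, Complex.star_def,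
    Complex.conj_ofReal]

variable {n : Type*} [Fintype n] [DecidableEq n]

/-- The Hermitian matrix with eigenvalues `d` and eigenvectors the columns of the unitary `V`. -/
noncomputable def unitaryConjDiagonal (V : unitaryGroup n ℂ) (d : n → ℝ) : Matrix n n ℂ :=
  (V : Matrix n n ℂ) * diagonal (fun j => (d j : ℂ)) * star (V : Matrix n n ℂ)

/-- Squared moduli of the coordinates of `v` in the orthonormal basis of columns of `V`. -/
noncomputable def coordSq (V : unitaryGroup n ℂ) (v : n → ℂ) (j : n) : ℝ :=
  ‖(star (V : Matrix n n ℂ) *ᵥ v) j‖ ^ 2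


lemma coordSq_nonneg (V : unitaryGroup n ℂ) (v : n → ℂ) (j : n) : 0 ≤ coordSq V v j :=
  sq_nonneg _

lemma unitaryConjDiagonal_mul (V : unitaryGroup n ℂ) (d e : n → ℝ) :
    unitaryConjDiagonal V d * unitaryConjDiagonal V e =
      unitaryConjDiagonal V (fun j => d j * e j) := by
  have h : star (V : Matrix n n ℂ) * (V : Matrix n n ℂ) = 1 := Unitary.coe_star_mul_self V
  calc unitaryConjDiagonal V d * unitaryConjDiagonal V e
      = (V : Matrix n n ℂ) * diagonal (fun j => (d j : ℂ)) *
          (star (V : Matrix n n ℂ) * (V : Matrix n n ℂ)) *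
          (diagonal (fun j => (e j : ℂ)) * star (V : Matrix n n ℂ)) := by
        simp only [unitaryConjDiagonal, Matrix.mul_assoc]
    _ = (V : Matrix n n ℂ) * (diagonal (fun j => (d j : ℂ)) * diagonal (fun j => (e j : ℂ))) *
          star (V : Matrix n n ℂ) := by
        simp only [h, Matrix.mul_one, Matrix.mul_assoc]
    _ = _ := by simp [unitaryConjDiagonal, diagonal_mul_diagonal]

lemma unitaryConjDiagonal_const (V : unitaryGroup n ℂ) (c : ℝ) :
    unitaryConjDiagonal V (fun _ => c) = (c : ℂ) • 1 := by
  have h : (V : Matrix n n ℂ) * star (V : Matrix n n ℂ) = 1 := Unitary.coe_mul_star_self V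
  have h' : diagonal (fun _ : n => (c : ℂ)) = (c : ℂ) • 1 := by
    rw [smul_one_eq_diagonal]
  rw [unitaryConjDiagonal, h', Matrix.mul_smul, Matrix.mul_one, Matrix.smul_mul, h]

lemma unitaryConjDiagonal_sub (V : unitaryGroup n ℂ) (d e : n → ℝ) :
    unitaryConjDiagonal V d - unitaryConjDiagonal V e =
      unitaryConjDiagonal V (fun j => d j - e j) := by
  simp only [unitaryConjDiagonal, ← Matrix.sub_mul, ← Matrix.mul_sub, diagonal_sub,
    Complex.ofReal_sub]

lemma unitaryConjDiagonal_inv (V : unitaryGroup n ℂ) {d : n → ℝ} (hd : ∀ j, d j ≠ 0) :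
    (unitaryConjDiagonal V d)⁻¹ = unitaryConjDiagonal V (fun j => (d j)⁻¹) := by
  apply inv_eq_right_inv
  rw [unitaryConjDiagonal_mul]
  simp only [mul_inv_cancel₀ (hd _), unitaryConjDiagonal_const, Complex.ofReal_one, one_smul]

lemma trace_unitaryConjDiagonal (V : unitaryGroup n ℂ) (d : n → ℝ) :
    trace (unitaryConjDiagonal V d) = ((∑ j, d j : ℝ) : ℂ) := by
  have h : star (V : Matrix n n ℂ) * (V : Matrix n n ℂ) = 1 := Unitary.coe_star_mul_self V
  rw [unitaryConjDiagonal, trace_mul_comm, ← Matrix.mul_assoc, h, Matrix.one_mul, trace_diagonal,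
    Complex.ofReal_sum]

lemma star_dotProduct_unitaryConjDiagonal_mulVec (V : unitaryGroup n ℂ) (d : n → ℝ)
    (v w : n → ℂ) :
    star w ⬝ᵥ (unitaryConjDiagonal V d *ᵥ v) =
      ∑ j, star ((star (V : Matrix n n ℂ) *ᵥ w) j) *
        ((d j : ℂ) * (star (V : Matrix n n ℂ) *ᵥ v) j) := by
  have h : star w ᵥ* (V : Matrix n n ℂ) = star (star (V : Matrix n n ℂ) *ᵥ w) := by
    rw [star_mulVec, star_eq_conjTranspose, conjTranspose_conjTranspose]
  rw [unitaryConjDiagonal, Matrix.mul_assoc, ← mulVec_mulVec, dotProduct_mulVec, h,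
    ← mulVec_mulVec]
  simp only [dotProduct, mulVec_diagonal, Pi.star_apply]

lemma quadForm_unitaryConjDiagonal (V : unitaryGroup n ℂ) (d : n → ℝ) (v : n → ℂ) :
    star v ⬝ᵥ (unitaryConjDiagonal V d *ᵥ v) = ((∑ j, d j * coordSq V v j : ℝ) : ℂ) := by
  rw [star_dotProduct_unitaryConjDiagonal_mulVec, Complex.ofReal_sum]
  refine Finset.sum_congr rfl fun j _ => ?_
  rw [coordSq, Complex.ofReal_mul, Complex.ofReal_pow, ← Complex.conj_mul', Complex.star_def]
  ring

lemma sum_coordSq (V : unitaryGroup n ℂ) (v : n → ℂ) :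
    ∑ j, coordSq V v j = ∑ j, ‖v j‖ ^ 2 := by
  have h := quadForm_unitaryConjDiagonal V (fun _ => 1) v
  rw [unitaryConjDiagonal_const, Complex.ofReal_one, one_smul, one_mulVec] at h
  simp only [one_mul] at h
  apply Complex.ofReal_injective
  rw [← h, dotProduct, Complex.ofReal_sum]
  refine Finset.sum_congr rfl fun j _ => ?_
  rw [Complex.ofReal_pow, ← Complex.conj_mul', Pi.star_apply, Complex.star_def]

/-- Cauchy–Schwarz inequality for the form with positive eigenvalues `d`. -/
lemma norm_star_dotProduct_sq_le (V : unitaryGroup n ℂ) {d : n → ℝ} (hd : ∀ j, 0 < d j)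
    (v w : n → ℂ) :
    ‖star v ⬝ᵥ w‖ ^ 2 ≤ (∑ j, (d j)⁻¹ * coordSq V v j) * ∑ j, d j * coordSq V w j := by
  have h := star_dotProduct_unitaryConjDiagonal_mulVec V (fun _ => 1) w v
  rw [unitaryConjDiagonal_const, Complex.ofReal_one, one_smul, one_mulVec] at h
  rw [h]
  have h₁ : ‖∑ j, star ((star (V : Matrix n n ℂ) *ᵥ v) j) *
        (1 * (star (V : Matrix n n ℂ) *ᵥ w) j)‖ ≤
      ∑ j, ‖(star (V : Matrix n n ℂ) *ᵥ v) j‖ * ‖(star (V : Matrix n n ℂ) *ᵥ w) j‖ := by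
    refine (norm_sum_le _ _).trans_eq (Finset.sum_congr rfl fun j _ => ?_)
    simp
  refine (pow_le_pow_left₀ (norm_nonneg _) h₁ 2).trans ?_
  refine Finset.sum_sq_le_sum_mul_sum_of_sq_le_mul _ (fun j _ => ?_) (fun j _ => ?_)
    fun j _ => ?_
  · exact mul_nonneg (inv_nonneg.2 (hd j).le) (coordSq_nonneg V v j)
  · exact mul_nonneg (hd j).le (coordSq_nonneg V w j)
  · have := (hd j).ne'
    refine le_of_eq ?_
    simp only [coordSq]
    field_simp

/-- Sherman–Morrison formula for the trace of the inverse. -/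
lemma trace_inv_add_smul_vecMulVec {N R : Matrix n n ℂ} (hNR : N * R = 1) (s : ℂ) (v w : n → ℂ)
    (h : 1 + s * (w ⬝ᵥ (R *ᵥ v)) ≠ 0) :
    trace (N + s • vecMulVec v w)⁻¹ =
      trace R - s * (w ⬝ᵥ ((R ^ 2) *ᵥ v)) / (1 + s * (w ⬝ᵥ (R *ᵥ v))) := by
  set q := w ⬝ᵥ (R *ᵥ v) with hq
  have hinv : (N + s • vecMulVec v w)⁻¹ =
      R - (s / (1 + s * q)) • vecMulVec (R *ᵥ v) (w ᵥ* R) := by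
    apply inv_eq_right_inv
    have h₁ : N * vecMulVec (R *ᵥ v) (w ᵥ* R) = vecMulVec v (w ᵥ* R) := by
      rw [mul_vecMulVec, mulVec_mulVec, hNR, one_mulVec]
    have h₂ : vecMulVec v w * vecMulVec (R *ᵥ v) (w ᵥ* R) = q • vecMulVec v (w ᵥ* R) := by
      rw [vecMulVec_mul_vecMulVec, ← hq, vecMulVec_smul]
    rw [Matrix.add_mul, Matrix.mul_sub, Matrix.mul_sub, hNR, Matrix.mul_smul, h₁,
      Matrix.smul_mul, vecMulVec_mul, Matrix.smul_mul, Matrix.mul_smul, h₂]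
    have h₃ : s - s / (1 + s * q) - s * (s / (1 + s * q) * q) = 0 := by
      field_simp
      ring
    calc _ = 1 + (s - s / (1 + s * q) - s * (s / (1 + s * q) * q)) • vecMulVec v (w ᵥ* R) := by
          module
      _ = 1 := by rw [h₃, zero_smul, add_zero]
  rw [hinv, trace_sub, trace_smul, trace_vecMulVec, pow_two, ← mulVec_mulVec, dotProduct_comm,
    ← dotProduct_mulVec, smul_eq_mul]
  ring

lemma trace_inv_unitaryConjDiagonal_add (V : unitaryGroup n ℂ) {d : n → ℝ} (hd : ∀ j, d j ≠ 0)
    (s : ℝ) (v : n → ℂ) (h : 1 + s * ∑ j, (d j)⁻¹ * coordSq V v j ≠ 0) :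
    (trace (unitaryConjDiagonal V d + (s : ℂ) • vecMulVec v (star v))⁻¹).re =
      ∑ j, (d j)⁻¹ - s * (∑ j, ((d j)⁻¹ * (d j)⁻¹) * coordSq V v j) /
        (1 + s * ∑ j, (d j)⁻¹ * coordSq V v j) := by
  have hNR : unitaryConjDiagonal V d * unitaryConjDiagonal V (fun j => (d j)⁻¹) = 1 := by
    rw [unitaryConjDiagonal_mul]
    simp only [mul_inv_cancel₀ (hd _), unitaryConjDiagonal_const, Complex.ofReal_one, one_smul]
  have h' : 1 + (s : ℂ) * (star v ⬝ᵥ (unitaryConjDiagonal V (fun j => (d j)⁻¹) *ᵥ v)) ≠ 0 := by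
    rw [quadForm_unitaryConjDiagonal]
    exact_mod_cast h
  rw [trace_inv_add_smul_vecMulVec hNR _ _ _ h', pow_two, unitaryConjDiagonal_mul,
    quadForm_unitaryConjDiagonal, quadForm_unitaryConjDiagonal, trace_unitaryConjDiagonal]
  norm_cast

lemma coordSq_eq_norm_dotProduct_col (V : unitaryGroup n ℂ) (v : n → ℂ) (j : n) :
    coordSq V v j = ‖star v ⬝ᵥ (V : Matrix n n ℂ).col j‖ ^ 2 := by
  have h : (star (V : Matrix n n ℂ) *ᵥ v) j = star (star v ⬝ᵥ (V : Matrix n n ℂ).col j) := by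
    simp [mulVec, dotProduct, star_apply, mul_comm]
  rw [coordSq, h, norm_star]

lemma sum_norm_col_sq (V : unitaryGroup n ℂ) (j : n) :
    ∑ k, ‖(V : Matrix n n ℂ).col j k‖ ^ 2 = 1 := by
  have h : (star (V : Matrix n n ℂ) * (V : Matrix n n ℂ)) j j = 1 := by
    rw [Unitary.coe_star_mul_self V, one_apply_eq]
  apply Complex.ofReal_injective
  rw [Complex.ofReal_one, ← h, mul_apply, Complex.ofReal_sum]
  refine Finset.sum_congr rfl fun k _ => ?_
  rw [Complex.ofReal_pow, ← Complex.conj_mul', star_apply, Complex.star_def, col_apply]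

lemma re_quadForm_unitaryConjDiagonal_add (V : unitaryGroup n ℂ) (d : n → ℝ) (t : ℝ)
    (v x : n → ℂ) :
    (star x ⬝ᵥ ((unitaryConjDiagonal V d + (t : ℂ) • vecMulVec v (star v)) *ᵥ x)).re =
      ∑ j, d j * coordSq V x j + t * ‖star v ⬝ᵥ x‖ ^ 2 := by
  have h : star x ⬝ᵥ v = star (star v ⬝ᵥ x) := by
    rw [star_dotProduct]
  rw [add_mulVec, dotProduct_add, quadForm_unitaryConjDiagonal, smul_mulVec, vecMulVec_mulVec,
    dotProduct_smul, dotProduct_smul, h, op_smul_eq_smul, smul_eq_mul, smul_eq_mul,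
    Complex.star_def, Complex.mul_conj', Complex.add_re, Complex.ofReal_re]
  norm_cast

lemma IsHermitian.sum_norm_eigenvectorBasis_sq {A : Matrix n n ℂ} (hA : A.IsHermitian) (i : n) :
    ∑ j, ‖hA.eigenvectorBasis i j‖ ^ 2 = 1 := by
  rw [← EuclideanSpace.norm_sq_eq, hA.eigenvectorBasis.norm_eq_one, one_pow]

/-- A positive rank-one perturbation keeps the eigenvalues above a strict lower bound. -/
lemma lt_eigenvalues_add_smul_vecMulVec (V : unitaryGroup n ℂ) {d : n → ℝ} {c t : ℝ}
    (hd : ∀ j, c < d j) (ht : 0 ≤ t) (v : n → ℂ)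
    (hA : (unitaryConjDiagonal V d + (t : ℂ) • vecMulVec v (star v)).IsHermitian) (i : n) :
    c < hA.eigenvalues i := by
  let x : n → ℂ := ⇑(hA.eigenvectorBasis i)
  have hsum : ∑ j, coordSq V x j = 1 := by
    rw [sum_coordSq]; exact hA.sum_norm_eigenvectorBasis_sq i
  have hpos : 0 < ∑ j, (d j - c) * coordSq V x j :=
    sum_mul_pos_of_sum_pos (fun j => sub_pos.2 (hd j)) (coordSq_nonneg V x) (by rw [hsum]; simp)
  simp only [sub_mul, Finset.sum_sub_distrib, ← Finset.mul_sum, hsum] at hpos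
  have heq : hA.eigenvalues i = _ :=
    (hA.eigenvalues_eq i).trans (re_quadForm_unitaryConjDiagonal_add V d t v x)
  rw [heq]
  have := mul_nonneg ht (sq_nonneg ‖star v ⬝ᵥ x‖)
  linarith

/-- A small enough positive rank-one perturbation keeps the eigenvalues below a strict upper
bound. -/
lemma eigenvalues_add_smul_vecMulVec_lt (V : unitaryGroup n ℂ) {d : n → ℝ} {c t : ℝ}
    (hd : ∀ j, d j < c) (ht : 0 ≤ t) (v : n → ℂ)
    (htv : t * ∑ j, (c - d j)⁻¹ * coordSq V v j < 1)
    (hA : (unitaryConjDiagonal V d + (t : ℂ) • vecMulVec v (star v)).IsHermitian) (i : n) :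
    hA.eigenvalues i < c := by
  let x : n → ℂ := ⇑(hA.eigenvectorBasis i)
  have hsum : ∑ j, coordSq V x j = 1 := by
    rw [sum_coordSq]; exact hA.sum_norm_eigenvectorBasis_sq i
  have hpos : 0 < ∑ j, (c - d j) * coordSq V x j :=
    sum_mul_pos_of_sum_pos (fun j => sub_pos.2 (hd j)) (coordSq_nonneg V x) (by rw [hsum]; simp)
  have hcs := mul_le_mul_of_nonneg_left
    (norm_star_dotProduct_sq_le V (fun j => sub_pos.2 (hd j)) v x) ht
  have hlt := mul_lt_mul_of_pos_right htv hpos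
  rw [mul_assoc] at hlt
  simp only [sub_mul, Finset.sum_sub_distrib, ← Finset.mul_sum, hsum] at hpos hcs hlt
  have heq : hA.eigenvalues i = _ :=
    (hA.eigenvalues_eq i).trans (re_quadForm_unitaryConjDiagonal_add V d t v x)
  rw [heq]
  linarith

lemma IsHermitian.eq_unitaryConjDiagonal {A : Matrix n n ℂ} (hA : A.IsHermitian) :
    A = unitaryConjDiagonal hA.eigenvectorUnitary hA.eigenvalues := by
  conv_lhs => rw [hA.spectral_theorem]
  rw [Unitary.conjStarAlgAut_apply]
  rfl

end Matrix

section Spectrum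

variable {m : ℕ} {A : Matrix (Fin m) (Fin m) ℂ}

lemma setOf_ofReal_mem_spectrum (hA : A.IsHermitian) :
    {x : ℝ | (x : ℂ) ∈ spectrum ℂ A} = Set.range hA.eigenvalues := by
  ext x
  rw [Set.mem_ofPred_eq, hA.spectrum_eq_image_range]
  constructor
  · rintro ⟨z, hz, hzx⟩
    rwa [← Complex.ofReal_injective hzx]
  · exact fun hx => ⟨x, hx, rfl⟩

lemma lt_specMin_iff (hm : 0 < m) (hA : A.IsHermitian) (c : ℝ) :
    c < specMin A ↔ ∀ j, c < hA.eigenvalues j := by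
  have : Nonempty (Fin m) := ⟨⟨0, hm⟩⟩
  rw [specMin, setOf_ofReal_mem_spectrum hA,
    (Set.finite_range _).lt_csInf_iff (Set.range_nonempty _), Set.forall_mem_range]

lemma specMax_lt_iff (hm : 0 < m) (hA : A.IsHermitian) (c : ℝ) :
    specMax A < c ↔ ∀ j, hA.eigenvalues j < c := by
  have : Nonempty (Fin m) := ⟨⟨0, hm⟩⟩
  rw [specMax, setOf_ofReal_mem_spectrum hA,
    (Set.finite_range _).csSup_lt_iff (Set.range_nonempty _), Set.forall_mem_range]

end Spectrum

section Potentials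

variable {m : ℕ} (V : unitaryGroup (Fin m) ℂ) (d : Fin m → ℝ)

lemma lowPot_unitaryConjDiagonal {c : ℝ} (h : ∀ j, c < d j) :
    lowPot (unitaryConjDiagonal V d) c = ∑ j, (d j - c)⁻¹ := by
  rw [lowPot, ← unitaryConjDiagonal_const V, unitaryConjDiagonal_sub,
    unitaryConjDiagonal_inv V fun j => (sub_pos.2 (h j)).ne', trace_unitaryConjDiagonal,
    Complex.ofReal_re]

lemma upPot_unitaryConjDiagonal {c : ℝ} (h : ∀ j, d j < c) :
    upPot (unitaryConjDiagonal V d) c = ∑ j, (c - d j)⁻¹ := by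
  rw [upPot, ← unitaryConjDiagonal_const V, unitaryConjDiagonal_sub,
    unitaryConjDiagonal_inv V fun j => (sub_pos.2 (h j)).ne', trace_unitaryConjDiagonal,
    Complex.ofReal_re]

lemma LA_unitaryConjDiagonal (v : Fin m → ℂ) {l δ : ℝ} (hδ : 0 < δ) (h : ∀ j, l + δ < d j) :
    LA (unitaryConjDiagonal V d) v l δ =
      (∑ j, ((d j - (l + δ))⁻¹ * (d j - (l + δ))⁻¹) * coordSq V v j) /
        (∑ j, (d j - (l + δ))⁻¹ - ∑ j, (d j - l)⁻¹) -
      ∑ j, (d j - (l + δ))⁻¹ * coordSq V v j := by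
  rw [LA, lowPot_unitaryConjDiagonal V d h,
    lowPot_unitaryConjDiagonal V d fun j => by linarith [h j], ← unitaryConjDiagonal_const V,
    unitaryConjDiagonal_sub, unitaryConjDiagonal_inv V fun j => (sub_pos.2 (h j)).ne', pow_two,
    unitaryConjDiagonal_mul, quadForm_unitaryConjDiagonal, quadForm_unitaryConjDiagonal,
    Complex.ofReal_re, Complex.ofReal_re]

lemma UA_unitaryConjDiagonal (v : Fin m → ℂ) {u δ : ℝ} (hδ : 0 < δ) (h : ∀ j, d j < u) :
    UA (unitaryConjDiagonal V d) v u δ =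
      (∑ j, ((u + δ - d j)⁻¹ * (u + δ - d j)⁻¹) * coordSq V v j) /
        (∑ j, (u - d j)⁻¹ - ∑ j, (u + δ - d j)⁻¹) +
      ∑ j, (u + δ - d j)⁻¹ * coordSq V v j := by
  have h' : ∀ j, d j < u + δ := fun j => by linarith [h j]
  rw [UA, upPot_unitaryConjDiagonal V d h,
    upPot_unitaryConjDiagonal V d h', ← unitaryConjDiagonal_const V,
    unitaryConjDiagonal_sub, unitaryConjDiagonal_inv V fun j => (sub_pos.2 (h' j)).ne', pow_two,
    unitaryConjDiagonal_mul, quadForm_unitaryConjDiagonal, quadForm_unitaryConjDiagonal,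
    Complex.ofReal_re, Complex.ofReal_re]

lemma UA_pos [NeZero m] {v : Fin m → ℂ} (hv : v ≠ 0) {u δ : ℝ} (hδ : 0 < δ) (h : ∀ j, d j < u) :
    0 < UA (unitaryConjDiagonal V d) v u δ := by
  have hw : ∀ j, 0 < (u + δ - d j)⁻¹ := fun j => inv_pos.2 (by linarith [h j])
  have hc : 0 < ∑ j, coordSq V v j := by
    rw [sum_coordSq]
    obtain ⟨j, hj⟩ := Function.ne_iff.1 hv
    exact Finset.sum_pos' (fun k _ => sq_nonneg _)
      ⟨j, Finset.mem_univ j, pow_pos (norm_pos_iff.2 hj) 2⟩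
  rw [UA_unitaryConjDiagonal V d v hδ h]
  refine add_pos (div_pos ?_ (sub_pos.2 (sum_inv_lt_sum_inv (fun j => sub_pos.2 (h j))
    fun j => by linarith))) ?_
  · exact sum_mul_pos_of_sum_pos (fun j => mul_pos (hw j) (hw j)) (coordSq_nonneg V v) hc
  · exact sum_mul_pos_of_sum_pos hw (coordSq_nonneg V v) hc

/-- Rank-one update at the lower barrier. -/
lemma lowPot_add_smul_vecMulVec_le [NeZero m] (v : Fin m → ℂ) {l δ t : ℝ} (hδ : 0 < δ)
    (ht : 0 < t) (h : ∀ j, l + δ < d j) (hL : 1 / t ≤ LA (unitaryConjDiagonal V d) v l δ) :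
    lowPot (unitaryConjDiagonal V d + (t : ℂ) • vecMulVec v (star v)) (l + δ) ≤
      lowPot (unitaryConjDiagonal V d) l := by
  have hl : ∀ j, l < d j := fun j => by linarith [h j]
  have hw : ∀ j, 0 < d j - (l + δ) := fun j => sub_pos.2 (h j)
  have hD := sub_pos.2 (sum_inv_lt_sum_inv hw (b := fun j => d j - l) fun j => by linarith)
  have hq : 0 ≤ ∑ j, (d j - (l + δ))⁻¹ * coordSq V v j :=
    Finset.sum_nonneg fun j _ => mul_nonneg (inv_pos.2 (hw j)).le (coordSq_nonneg V v j)
  have hden : 0 < 1 + t * ∑ j, (d j - (l + δ))⁻¹ * coordSq V v j := by positivity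
  rw [LA_unitaryConjDiagonal V d v hδ h, le_sub_iff_add_le, le_div_iff₀ hD] at hL
  rw [lowPot_unitaryConjDiagonal V d hl, lowPot, add_sub_right_comm,
    ← unitaryConjDiagonal_const V, unitaryConjDiagonal_sub,
    trace_inv_unitaryConjDiagonal_add V (fun j => (hw j).ne') t v hden.ne', sub_le_comm,
    le_div_iff₀ hden]
  have := mul_le_mul_of_nonneg_left hL ht.le
  rw [← mul_assoc, mul_add, mul_one_div_cancel ht.ne'] at this
  linarith

lemma mul_sum_coordSq_lt_one [NeZero m] (v : Fin m → ℂ) {u δ t : ℝ} (hδ : 0 < δ) (ht : 0 < t)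
    (h : ∀ j, d j < u) (hU : UA (unitaryConjDiagonal V d) v u δ ≤ 1 / t) :
    t * ∑ j, (u + δ - d j)⁻¹ * coordSq V v j < 1 := by
  have hw : ∀ j, 0 < (u + δ - d j)⁻¹ := fun j => inv_pos.2 (by linarith [h j])
  rw [UA_unitaryConjDiagonal V d v hδ h] at hU
  have hD := sub_pos.2 (sum_inv_lt_sum_inv (fun j => sub_pos.2 (h j))
    (b := fun j => u + δ - d j) fun j => by linarith)
  rw [← lt_div_iff₀' ht]
  rcases (Finset.sum_nonneg fun j (_ : j ∈ Finset.univ) => coordSq_nonneg V v j).lt_or_eq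
    with hc | hc
  · have := div_pos (sum_mul_pos_of_sum_pos (fun j => mul_pos (hw j) (hw j))
      (coordSq_nonneg V v) hc) hD
    linarith
  · have hz := (Finset.sum_eq_zero_iff_of_nonneg fun j _ => coordSq_nonneg V v j).1 hc.symm
    rw [Finset.sum_eq_zero fun j hj => by rw [hz j hj, mul_zero]]
    positivity

/-- Rank-one update at the upper barrier. -/
lemma upPot_add_smul_vecMulVec_le [NeZero m] (v : Fin m → ℂ) {u δ t : ℝ} (hδ : 0 < δ)
    (ht : 0 < t) (h : ∀ j, d j < u) (hU : UA (unitaryConjDiagonal V d) v u δ ≤ 1 / t) :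
    upPot (unitaryConjDiagonal V d + (t : ℂ) • vecMulVec v (star v)) (u + δ) ≤
      upPot (unitaryConjDiagonal V d) u := by
  have hw : ∀ j, 0 < u + δ - d j := fun j => by linarith [h j]
  have hD := sub_pos.2 (sum_inv_lt_sum_inv (fun j => sub_pos.2 (h j))
    (b := fun j => u + δ - d j) fun j => by linarith)
  have hden : 0 < 1 + -t * ∑ j, (u + δ - d j)⁻¹ * coordSq V v j := by
    linarith [mul_sum_coordSq_lt_one V d v hδ ht h hU]
  rw [UA_unitaryConjDiagonal V d v hδ h, ← le_sub_iff_add_le, div_le_iff₀ hD] at hU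
  have hsplit : ((u + δ : ℝ) : ℂ) • (1 : Matrix (Fin m) (Fin m) ℂ) -
      (unitaryConjDiagonal V d + (t : ℂ) • vecMulVec v (star v)) =
      unitaryConjDiagonal V (fun j => u + δ - d j) +
        ((-t : ℝ) : ℂ) • vecMulVec v (star v) := by
    rw [← unitaryConjDiagonal_sub V (fun _ => u + δ) d, unitaryConjDiagonal_const,
      Complex.ofReal_neg, neg_smul]
    abel
  rw [upPot_unitaryConjDiagonal V d h, upPot, hsplit,
    trace_inv_unitaryConjDiagonal_add V (fun j => (hw j).ne') (-t) v hden.ne', sub_le_comm,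
    le_div_iff₀ hden]
  have := mul_le_mul_of_nonneg_left hU ht.le
  rw [← mul_assoc, mul_sub t, mul_one_div_cancel ht.ne'] at this
  linarith

end Potentials

/-- The well-determined update step (Lemma `lem3.5`). -/
theorem stmt_8 (m M : ℕ) (hm : 0 < m) (y : Fin M → Fin m → ℂ) (A₀ B₀ : ℝ)
    (hA₀ : 0 < A₀) (hAB : A₀ ≤ B₀)
    (hframe : ∀ x : Fin m → ℂ,
      A₀ * ∑ j, ‖x j‖ ^ 2 ≤ ∑ i, ‖star (y i) ⬝ᵥ x‖ ^ 2 ∧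
      ∑ i, ‖star (y i) ⬝ᵥ x‖ ^ 2 ≤ B₀ * ∑ j, ‖x j‖ ^ 2)
    (κ : ℝ)
    (hκ : κ = (B₀ / (2 * A₀) + 1 / 2) + Real.sqrt ((B₀ / (2 * A₀) + 1 / 2) ^ 2 - 1))
    (A : Matrix (Fin m) (Fin m) ℂ) (hA : A.IsHermitian)
    (l u : ℝ) (hl : l < specMin A) (hu : specMax A < u)
    (δL δU εL εU : ℝ) (hδL : 0 < δL) (hδU : 0 < δU) (hεL : 0 < εL) (hεU : 0 < εU)
    (hcond : 0 < B₀ / A₀ * (1 / δU + εU) ∧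
      B₀ / A₀ * (1 / δU + εU) ≤ 1 / δL - κ * εL)
    (hPL : lowPot A l ≤ εL) (hPU : upPot A u ≤ εU) :
    (∃ i : Fin M, UA A (y i) u δU ≤ LA A (y i) l δL ∧ 0 < UA A (y i) u δU) ∧
    (∀ i : Fin M, UA A (y i) u δU ≤ LA A (y i) l δL →
      ∀ t : ℝ, 0 < t → 1 / t ≤ LA A (y i) l δL → UA A (y i) u δU ≤ 1 / t →
        l + δL < specMin (A + (t : ℂ) • Matrix.vecMulVec (y i) (star (y i))) ∧
        specMax (A + (t : ℂ) • Matrix.vecMulVec (y i) (star (y i))) < u + δU ∧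
        lowPot (A + (t : ℂ) • Matrix.vecMulVec (y i) (star (y i))) (l + δL) ≤
          lowPot A l ∧
        upPot (A + (t : ℂ) • Matrix.vecMulVec (y i) (star (y i))) (u + δU) ≤
          upPot A u) := by
  have : NeZero m := ⟨hm.ne'⟩
  obtain ⟨V, d, rfl, hld, hud⟩ : ∃ (V : unitaryGroup (Fin m) ℂ) (d : Fin m → ℝ),
      A = unitaryConjDiagonal V d ∧ (∀ j, l < d j) ∧ ∀ j, d j < u :=
    ⟨_, _, hA.eq_unitaryConjDiagonal, (lt_specMin_iff hm hA l).1 hl, (specMax_lt_iff hm hA u).1 hu⟩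
  obtain ⟨hpos, hle⟩ := hcond
  rw [lowPot_unitaryConjDiagonal V d hld] at hPL
  rw [upPot_unitaryConjDiagonal V d hud] at hPU
  have hR : 1 ≤ B₀ / A₀ := (one_le_div hA₀).2 hAB
  have hκR : B₀ / A₀ ≤ κ := by
    have hhalf : B₀ / (2 * A₀) = B₀ / A₀ / 2 := by
      field_simp
    rw [hκ, hhalf, ← sub_le_iff_le_add']
    refine Real.le_sqrt_of_sq_le ?_
    linarith
  have hκ0 : 0 < κ := by linarith
  have hκΦ : κ * ∑ j, (d j - l)⁻¹ ≤ κ * εL := mul_le_mul_of_nonneg_left hPL hκ0.le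
  have hldδ : ∀ j, l + δL < d j := fun j => by
    have h₁ : (d j - l)⁻¹ ≤ ∑ j, (d j - l)⁻¹ :=
      Finset.single_le_sum (f := fun j => (d j - l)⁻¹)
        (fun k _ => (inv_pos.2 (sub_pos.2 (hld k))).le) (Finset.mem_univ j)
    have h₂ : εL ≤ κ * εL := le_mul_of_one_le_left hεL.le (hR.trans hκR)
    have h₃ : (d j - l)⁻¹ < δL⁻¹ := by rw [← one_div δL]; linarith
    linarith [(inv_lt_inv₀ (sub_pos.2 (hld j)) hδL).1 h₃]
  refine ⟨?_, ?_⟩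
  · have hfr : ∀ j, A₀ ≤ ∑ i, coordSq V (y i) j ∧ ∑ i, coordSq V (y i) j ≤ B₀ := fun j => by
      simpa only [coordSq_eq_norm_dotProduct_col, sum_norm_col_sq, mul_one] using
        hframe ((V : Matrix (Fin m) (Fin m) ℂ).col j)
    have hswap : ∀ w : Fin m → ℝ, ∑ i, ∑ j, w j * coordSq V (y i) j =
        ∑ j, w j * ∑ i, coordSq V (y i) j := fun w => by
      rw [Finset.sum_comm]
      exact Finset.sum_congr rfl fun j _ => (Finset.mul_sum _ _ _).symm
    have hsumL : A₀ * (1 / δL - κ * ∑ j, (d j - l)⁻¹) ≤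
        ∑ i, LA (unitaryConjDiagonal V d) (y i) l δL := by
      simp only [LA_unitaryConjDiagonal V d _ hδL hldδ, Finset.sum_sub_distrib,
        ← Finset.sum_div, hswap]
      exact le_lower_barrier_sum_s8 hδL hA₀ (fun j => sub_pos.2 (hldδ j)) (fun j => by ring)
        (fun j => (hfr j).1) (fun j => (hfr j).2.trans ((div_le_iff₀' hA₀).1 hκR))
        (by linarith)
    have hsumU : ∑ i, UA (unitaryConjDiagonal V d) (y i) u δU ≤
        B₀ * (1 / δU + ∑ j, (u - d j)⁻¹) := by
      simp only [UA_unitaryConjDiagonal V d _ hδU hud, Finset.sum_add_distrib,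
        ← Finset.sum_div, hswap]
      exact upper_barrier_sum_le_s8 hδU (fun j => sub_pos.2 (hud j)) (fun j => by ring)
        (fun j => hA₀.le.trans (hfr j).1) (fun j => (hfr j).2)
    have hUL : ∑ i, UA (unitaryConjDiagonal V d) (y i) u δU ≤
        ∑ i, LA (unitaryConjDiagonal V d) (y i) l δL := by
      have h₁ : B₀ * (1 / δU + ∑ j, (u - d j)⁻¹) ≤ B₀ * (1 / δU + εU) :=
        mul_le_mul_of_nonneg_left (by linarith) (hA₀.le.trans hAB)
      have h₂ : B₀ * (1 / δU + εU) = A₀ * (B₀ / A₀ * (1 / δU + εU)) := by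
        field_simp
      have h₃ : A₀ * (B₀ / A₀ * (1 / δU + εU)) ≤ A₀ * (1 / δL - κ * ∑ j, (d j - l)⁻¹) :=
        mul_le_mul_of_nonneg_left (by linarith) hA₀.le
      linarith
    by_contra! hne
    have hlt : ∀ i, y i ≠ 0 → LA (unitaryConjDiagonal V d) (y i) l δL <
        UA (unitaryConjDiagonal V d) (y i) u δU := fun i hi => by
      by_contra! hi'
      exact (hne i hi').not_gt (UA_pos V d hi hδU hud)
    have hle' : ∀ i, LA (unitaryConjDiagonal V d) (y i) l δL ≤
        UA (unitaryConjDiagonal V d) (y i) u δU := fun i => by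
      by_cases hi : y i = 0
      · simp [LA, UA, hi]
      · exact (hlt i hi).le
    obtain ⟨i, hi⟩ : ∃ i, y i ≠ 0 := by
      by_contra! hy
      have := (hfr 0).1
      simp only [hy, coordSq, mulVec_zero, Pi.zero_apply, norm_zero] at this
      simp at this
      linarith
    exact hUL.not_gt
      (Finset.sum_lt_sum (fun i _ => hle' i) ⟨i, Finset.mem_univ i, hlt i hi⟩)
  · intro i _ t ht hL hU
    have hA' := isHermitian_add_smul_vecMulVec hA t (y i)
    have hud' : ∀ j, d j < u + δU := fun j => by linarith [hud j]
    exact ⟨(lt_specMin_iff hm hA' _).2 fun j =>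
        lt_eigenvalues_add_smul_vecMulVec V hldδ ht.le (y i) hA' j,
      (specMax_lt_iff hm hA' _).2 fun j => eigenvalues_add_smul_vecMulVec_lt V hud' ht.le (y i)
        (mul_sum_coordSq_lt_one V d (y i) hδU ht hud hU) hA' j,
      lowPot_add_smul_vecMulVec_le V d (y i) hδL ht hldδ hL,
      upPot_add_smul_vecMulVec_le V d (y i) hδU ht hud hU⟩
end
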